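/- Let n be a positive integer and J a proper subset of [n−1]. Let D_0^J(n) be the set of derangements σ of [n] with DES σ = J, and D_1^J(n) the set of permutations σ of [n] with DES σ = J and exactly one fixed point. Then there exists a polynomial Q(s) with nonnegative integer coefficients such that Σ_{σ∈D_0^J(n)} s^{iexc σ} − Σ_{σ∈D_1^J(n)} s^{iexc σ} = (s − 1)·Q(s) in ℤ[s]. -/

import Mathlib

/-- The value of a permutation of `[n] = {1, …, n}` at `i`, in 1-based terms:
for `1 ≤ i ≤ n` this is `σ(i) ∈ {1, …, n}`; outside `[n]` we return `i`. -/
def permToFun {n : ℕ} (σ : Equiv.Perm (Fin n)) (i : ℕ) : ℕ :=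
  if h : 1 ≤ i ∧ i ≤ n then ((σ ⟨i - 1, by omega⟩ : Fin n) : ℕ) + 1 else i

/-- `fix σ`: the number of fixed points of a permutation of `[n]`. -/
def fixCount {n : ℕ} (σ : Equiv.Perm (Fin n)) : ℕ :=
  ((Finset.Icc 1 n).filter fun i => permToFun σ i = i).card

/-- `exc σ`: the number of excedances of a permutation of `[n]`. -/
def excCount {n : ℕ} (σ : Equiv.Perm (Fin n)) : ℕ :=
  ((Finset.Icc 1 n).filter fun i => i < permToFun σ i).card

/-- `DES σ`: the descent set of a permutation of `[n]`, a subset of `[n-1]`. -/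
def desSet {n : ℕ} (σ : Equiv.Perm (Fin n)) : Finset ℕ :=
  (Finset.Icc 1 (n - 1)).filter fun i => permToFun σ (i + 1) < permToFun σ i

/-- The weakly increasing front factor of the hook factorization of a word. -/
def front : List ℕ → List ℕ
  | [] => []
  | a :: l => match front l with
    | [] => [a]
    | x :: p => if x < a then [] else a :: x :: p

/-- The number of negative letters contributed by all hooks of a word. -/
def anti : List ℕ → ℕ
  | [] => 0
  | a :: l => anti l + match front l with
    | [] => 0
    | x :: p => if x < a then 1 + (x :: p).countP (a ≤ ·) else 0

theorem front_cons (a : ℕ) (l : List ℕ) : front (a :: l) =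
    match front l with
    | [] => [a]
    | x :: p => if x < a then [] else a :: x :: p := rfl

theorem anti_cons (a : ℕ) (l : List ℕ) : anti (a :: l) = anti l + match front l with
    | [] => 0
    | x :: p => if x < a then 1 + (x :: p).countP (a ≤ ·) else 0 := rfl

theorem front_cons_eq {a b : ℕ} {l p : List ℕ} (h : front (a :: l) = b :: p) :
    a = b ∧ front l = p ∧ ∀ x ∈ p.head?, a ≤ x := by
  rw [front_cons] at h
  split at h <;> grind

theorem front_isChain (l : List ℕ) : (front l).IsChain (· ≤ ·) := by
  induction l with
  | nil => simp [front]
  | cons a l ih =>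
    rw [front_cons]
    split
    · simp
    · next x p hp => split <;> grind

theorem le_of_mem_front {l p : List ℕ} {b : ℕ} (h : front l = b :: p) : ∀ x ∈ p, b ≤ x := by
  have := (front_isChain l).pairwise
  rw [h] at this
  exact (List.pairwise_cons.1 this).1

/-- An elementary Knuth move on the first three letters of a word. -/
def knuth : List ℕ → List ℕ
  | a :: b :: c :: r =>
    if (a < c ∧ c < b) ∨ (b < c ∧ c < a) then b :: a :: c :: r
    else if (b < a ∧ a < c) ∨ (c < a ∧ a < b) then a :: c :: b :: r
    else a :: b :: c :: r
  | l => l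

/-- The involution pairing words with empty front factor and words with a one-letter front
factor. -/
def invo : List ℕ → List ℕ
  | [] => []
  | x :: v =>
    if (front v).length ≤ 1 ∧ v.headD x < x ∧ (invo v).headD x < x then x :: invo v
    else knuth (x :: v)

theorem knuth_perm (l : List ℕ) : (knuth l).Perm l := by
  unfold knuth
  split
  · split_ifs
    · exact List.Perm.swap _ _ _
    · exact (List.Perm.swap _ _ _).cons _
    · rfl
  · rfl

theorem invo_perm (l : List ℕ) : (invo l).Perm l := by
  induction l with
  | nil => rfl
  | cons x v ih =>
    rw [invo]
    split_ifs
    · exact ih.cons _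
    · exact knuth_perm _

theorem idxOf_knuth_lt (l : List ℕ) (i : ℕ) :
    (knuth l).idxOf i < (knuth l).idxOf (i + 1) ↔ l.idxOf i < l.idxOf (i + 1) := by
  unfold knuth
  split
  · split_ifs <;> simp only [List.idxOf_cons] <;> grind
  · rfl

theorem idxOf_invo_lt (l : List ℕ) (i : ℕ) :
    (invo l).idxOf i < (invo l).idxOf (i + 1) ↔ l.idxOf i < l.idxOf (i + 1) := by
  induction l with
  | nil => rfl
  | cons x v ih =>
    rw [invo]
    split_ifs
    · simp only [List.idxOf_cons]
      grind
    · exact idxOf_knuth_lt _ _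

/-- The inductive invariant of `invo`. -/
structure InvoSpec (l : List ℕ) : Prop where
  alt : (l.Pairwise (· > ·) ∧ invo l = l) ∨ (front l).length + (front (invo l)).length = 1
  up : (front l).length = 1 → (front (invo l)).length = 0 →
    anti (invo l) = anti l ∨ anti (invo l) = anti l + 1
  down : (front l).length = 0 → (front (invo l)).length = 1 →
    anti l = anti (invo l) ∨ anti l = anti (invo l) + 1
  inv : invo (invo l) = l
  head_le : (front l).length = 0 → ∀ x, (invo l).headD x ≤ l.headD x
  head_ne : (front l).length = 1 → ∀ x, (invo l).headD x ≠ l.headD x →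
    ∃ b c d r, l = b :: c :: d :: r ∧ b < d ∧ d < c ∧ (invo l).headD x = c

theorem front_eq_of_length {y : ℕ} {v : List ℕ} (h : (front (y :: v)).length = 1) :
    front (y :: v) = [y] := by
  rw [front_cons] at h ⊢
  split at h <;> grind

theorem invoSpec_rec {x y : ℕ} {v : List ℕ} (h1 : (front (y :: v)).length ≤ 1)
    (h2 : y < x) (h3 : (invo (y :: v)).headD x < x) (ih : InvoSpec (y :: v)) :
    InvoSpec (x :: y :: v) := by
  have e : invo (x :: y :: v) = x :: invo (y :: v) := by
    rw [invo, if_pos]; exact ⟨h1, h2, h3⟩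
  have hlen : (invo (y :: v)).length = v.length + 1 := by
    simpa using (invo_perm (y :: v)).length_eq
  obtain ⟨y', v', hy'⟩ : ∃ y' v', invo (y :: v) = y' :: v' := by
    cases h : invo (y :: v) with
    | nil => simp [h] at hlen
    | cons a b => exact ⟨a, b, rfl⟩
  have hinv := ih.inv
  rw [hy'] at e h3 hinv
  simp only [List.headD_cons] at h3
  have F : ∀ z w, z < x → (front (z :: w)).length = 1 →
      front (x :: z :: w) = [] ∧ anti (x :: z :: w) = anti (z :: w) + 1 := by
    intro z w hz h
    have := front_eq_of_length h
    rw [front_cons, anti_cons, this]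
    simp [hz]
  have G : ∀ z w, (front (z :: w)).length = 0 →
      front (x :: z :: w) = [x] ∧ anti (x :: z :: w) = anti (z :: w) := by
    intro z w h
    rw [List.length_eq_zero_iff] at h
    rw [front_cons, anti_cons, h]
    simp
  have alt := ih.alt
  have up := ih.up
  have down := ih.down
  rw [hy'] at alt up down
  have e2 : (front (y' :: v')).length ≤ 1 := by
    rcases alt with ⟨_, h⟩ | h
    · rw [h]; exact h1
    · omega
  have e3 : invo (x :: y' :: v') = x :: y :: v := by
    rw [invo, if_pos, hinv]
    rw [hinv]
    exact ⟨e2, h3, h2⟩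
  constructor
  · rw [e]
    rcases alt with ⟨hd, h⟩ | h
    · left
      refine ⟨?_, by rw [h]⟩
      rw [List.pairwise_cons]
      refine ⟨?_, hd⟩
      rw [List.pairwise_cons] at hd
      grind
    · right
      have a1 := F y v h2
      have a2 := G y v
      have a3 := F y' v' h3
      have a4 := G y' v'
      rcases (by omega : ((front (y :: v)).length = 0 ∧ (front (y' :: v')).length = 1) ∨
        ((front (y :: v)).length = 1 ∧ (front (y' :: v')).length = 0)) with ⟨b, c⟩ | ⟨b, c⟩
      · simp [(a2 b).1, (a3 c).1]
      · simp [(a1 b).1, (a4 c).1]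
  · rw [e]
    intro p q
    rcases (by omega : (front (y :: v)).length = 0 ∨ (front (y :: v)).length = 1) with b | b
    · rcases (by omega : (front (y' :: v')).length = 0 ∨ (front (y' :: v')).length = 1) with c | c
      · simp [(G y' v' c).1] at q
      · rw [(G y v b).2, (F y' v' h3 c).2]
        have := down b c
        omega
    · simp [(F y v h2 b).1] at p
  · rw [e]
    intro p q
    rcases (by omega : (front (y' :: v')).length = 0 ∨ (front (y' :: v')).length = 1) with b | b
    · rcases (by omega : (front (y :: v)).length = 0 ∨ (front (y :: v)).length = 1) with c | c
      · simp [(G y v c).1] at p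
      · rw [(G y' v' b).2, (F y v h2 c).2]
        have := up c b
        omega
    · simp [(F y' v' h3 b).1] at q
  · rw [e, e3]
  · rw [e]; simp
  · rw [e]; simp

theorem invoSpec_of_knuth {x : ℕ} {v m : List ℕ}
    (hm : invo (x :: v) = m) (hinv : invo m = x :: v)
    (h : ((front (x :: v)).length = 1 ∧ front m = [] ∧
        (anti m = anti (x :: v) ∨ anti m = anti (x :: v) + 1)) ∨
      (front (x :: v) = [] ∧ (front m).length = 1 ∧
        (anti (x :: v) = anti m ∨ anti (x :: v) = anti m + 1)))
    (h0 : front (x :: v) = [] → ∀ y, m.headD y ≤ x)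
    (h1 : (front (x :: v)).length = 1 → ∀ y, m.headD y ≠ x →
      ∃ b c d r, x :: v = b :: c :: d :: r ∧ b < d ∧ d < c ∧ m.headD y = c) :
    InvoSpec (x :: v) := by
  constructor
  · rw [hm]; right
    rcases h with ⟨a, b, c⟩ | ⟨a, b, c⟩ <;> simp [a, b]
  · rw [hm]
    intro p q
    rcases h with ⟨a, b, c⟩ | ⟨a, b, c⟩
    · exact c
    · simp [a] at p
  · rw [hm]
    intro p q
    rcases h with ⟨a, b, c⟩ | ⟨a, b, c⟩
    · simp [b] at q
    · exact c
  · rw [hm, hinv]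
  · rw [hm]; intro p y; exact h0 (List.length_eq_zero_iff.1 p) y
  · rw [hm]; simpa using h1

theorem invo_of_not {x : ℕ} {v : List ℕ}
    (h : ¬ ((front v).length ≤ 1 ∧ v.headD x < x ∧ (invo v).headD x < x)) :
    invo (x :: v) = knuth (x :: v) := by
  rw [invo, if_neg h]

theorem front_eq_cons {l p : List ℕ} {b : ℕ} (h : front l = b :: p) : ∃ r, l = b :: r := by
  cases l with
  | nil => simp [front] at h
  | cons a l => obtain ⟨rfl, -⟩ := front_cons_eq h; exact ⟨_, rfl⟩

theorem countP_le_of_lt {y : ℕ} {p : List ℕ} (x : ℕ) (hx : x < y) :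
    (x :: p).countP (y ≤ ·) = p.countP (y ≤ ·) := by
  simp [hx]

theorem countP_le_eq_length {y : ℕ} {p : List ℕ} (h : ∀ x ∈ p, y ≤ x) :
    p.countP (y ≤ ·) = p.length := by
  rw [List.countP_eq_length]; simpa using h

theorem invoSpec (l : List ℕ) (hl : l.Nodup) (hf : (front l).length ≤ 1) : InvoSpec l := by
  induction l with
  | nil => constructor <;> simp [invo, front]
  | cons x v ih =>
  have hx : x ∉ v := (List.nodup_cons.1 hl).1
  replace ih := ih (List.nodup_cons.1 hl).2
  by_cases hrec : (front v).length ≤ 1 ∧ v.headD x < x ∧ (invo v).headD x < x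
  · obtain ⟨h1, h2, h3⟩ := hrec
    cases v with
    | nil => simp at h2
    | cons y v => exact invoSpec_rec h1 h2 h3 (ih h1)
  have e := invo_of_not hrec
  rcases hv : front v with _ | ⟨y, p⟩
  · -- the front factor of `v` is empty
    rcases v with _ | ⟨y, v⟩
    · constructor <;> simp [invo, front, knuth]
    replace ih := ih (by simp [hv])
    have hyx : x < y := by
      by_contra hc
      have hne : y ≠ x := by rintro rfl; simp at hx
      have := ih.head_le (by simp [hv]) x
      apply hrec
      simp only [hv, List.headD_cons] at this ⊢
      refine ⟨by simp, by omega, by omega⟩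
    obtain ⟨z, p, hzp, hzy⟩ : ∃ z p, front v = z :: p ∧ z < y := by
      rw [front_cons] at hv
      split at hv
      · simp at hv
      · next z p hp => exact ⟨z, p, hp, by grind⟩
    obtain ⟨r, rfl⟩ := front_eq_cons hzp
    have hxz : x ≠ z := by rintro rfl; simp at hx
    have hfl : front (x :: y :: z :: r) = [x] := by rw [front_cons, hv]
    have hal : anti (x :: y :: z :: r) = anti (z :: r) + 1 + (z :: p).countP (y ≤ ·) := by
      rw [anti_cons, hv, anti_cons, hzp]; simp [hzy]; ring
    rcases lt_or_gt_of_ne hxz with hxz | hxz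
    · have e' : invo (x :: y :: z :: r) = y :: x :: z :: r := by
        rw [e, knuth, if_pos (Or.inl ⟨hxz, hzy⟩)]
      have f1 : front (x :: z :: r) = x :: z :: p := by
        rw [front_cons, hzp]; simp; omega
      have a1 : anti (x :: z :: r) = anti (z :: r) := by
        rw [anti_cons, hzp]; simp; omega
      refine invoSpec_of_knuth e' ?_ (Or.inl ⟨by simp [hfl], ?_, ?_⟩) ?_ ?_
      · rw [invo_of_not (by simp [f1]), knuth, if_pos (Or.inr ⟨hxz, hzy⟩)]
      · rw [front_cons, f1]; simp [hyx]
      · left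
        rw [anti_cons, f1, hal, a1]
        simp only [hyx, if_true]
        rw [countP_le_of_lt x hyx]; ring
      · simp [hfl]
      · intro _ _ _
        exact ⟨x, y, z, r, rfl, hxz, hzy, by simp⟩
    · have e' : invo (x :: y :: z :: r) = x :: z :: y :: r := by
        rw [e, knuth, if_neg (by omega), if_pos (by omega)]
      obtain ⟨-, hr, hp⟩ := front_cons_eq hzp
      have az : anti (z :: r) = anti r := by
        rw [anti_cons, hr]; cases p with
        | nil => simp
        | cons q p => simp at hp; simp; omega
      have key : front (x :: z :: y :: r) = [] ∧
          anti (x :: z :: y :: r) = anti r + 2 + p.countP (y ≤ ·) ∧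
          invo (x :: z :: y :: r) = x :: y :: z :: r := by
        have kn : knuth (x :: z :: y :: r) = x :: y :: z :: r := by
          rw [knuth, if_neg (by omega), if_pos (by omega)]
        by_cases hq : ∃ q p', p = q :: p' ∧ q < y
        · obtain ⟨q, p', rfl, hqy⟩ := hq
          obtain ⟨r', rfl⟩ := front_eq_cons hr
          have hq' : z ≤ q := hp q rfl
          have hzq : z ≠ q := by rintro rfl; simp at hl
          have f1 : front (y :: q :: r') = [] := by rw [front_cons, hr]; simp [hqy]
          have f2 : front (z :: y :: q :: r') = [z] := by rw [front_cons, f1]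
          refine ⟨by rw [front_cons, f2]; simp [hxz], ?_, ?_⟩
          · rw [anti_cons, f2, anti_cons, f1, anti_cons, hr]
            simp [hxz, hqy]
            ring
          · rw [← kn]
            apply invo_of_not
            have : invo (z :: y :: q :: r') = y :: z :: q :: r' := by
              rw [invo_of_not (by simp; omega), knuth, if_pos (by omega)]
            rw [this]; simp; omega
        · have f1 : front (y :: r) = y :: p := by
            rw [front_cons, hr]; cases p with
            | nil => rfl
            | cons q p => simp at hq ⊢; exact hq
          have a1 : anti (y :: r) = anti r := by
            rw [anti_cons, hr]; cases p with
            | nil => rfl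
            | cons q p => simp at hq; simp; omega
          have f2 : front (z :: y :: r) = z :: y :: p := by
            rw [front_cons, f1]; simp; omega
          have hyp := le_of_mem_front f1
          refine ⟨by rw [front_cons, f2]; simp [hxz], ?_, ?_⟩
          · rw [anti_cons, f2, anti_cons, f1, a1]
            simp only [hxz, if_true, hzy.not_gt, if_false, countP_le_eq_length hyp]
            rw [countP_le_of_lt z hxz, countP_le_eq_length (by grind)]
            simp; ring
          · rw [← kn]
            apply invo_of_not
            rw [f2]; simp
      refine invoSpec_of_knuth e' key.2.2 (Or.inl ⟨by simp [hfl], key.1, ?_⟩) ?_ ?_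
      · right
        rw [key.2.1, hal, countP_le_of_lt z hzy, az]; ring
      · simp [hfl]
      · simp
  · -- the front factor of `v` starts with `y`
    obtain ⟨v, rfl⟩ := front_eq_cons hv
    have hyx : y < x := by
      by_contra hc
      rw [front_cons, hv] at hf
      simp [hc] at hf
    have hfl : front (x :: y :: v) = [] := by rw [front_cons, hv]; simp [hyx]
    obtain ⟨-, hvp, hp⟩ := front_cons_eq hv
    have ay : anti (y :: v) = anti v := by
      rw [anti_cons, hvp]; cases p with
      | nil => simp
      | cons q p => simp at hp; simp; omega
    have hal : anti (x :: y :: v) = anti v + 1 + p.countP (x ≤ ·) := by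
      rw [anti_cons, hv, ay]; simp only [hyx, if_true]; rw [countP_le_of_lt y hyx]; ring
    rcases p with _ | ⟨z, p⟩
    · replace ih := ih (by simp [hv])
      have hb : x ≤ (invo (y :: v)).headD x := by
        by_contra hc
        exact hrec ⟨by simp [hv], by simpa using hyx, by omega⟩
      obtain ⟨b, c, d, r, h1, h2, h3, h4⟩ :=
        ih.head_ne (by simp [hv]) x (by rw [List.headD_cons]; omega)
      simp only [List.cons.injEq] at h1
      obtain ⟨rfl, rfl⟩ := h1
      have hcx : x ≠ c := by rintro rfl; simp at hx
      have hcx' : x < c := by omega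
      have e' : invo (x :: y :: c :: d :: r) = x :: c :: y :: d :: r := by
        rw [e, knuth, if_neg (by omega), if_pos (by omega)]
      obtain ⟨p, hzp⟩ : ∃ p, front (d :: r) = d :: p := by
        rw [front_cons] at hvp
        split at hvp
        · simp at hvp
        · next q p hp => obtain ⟨rfl, -⟩ := front_cons_eq hp; exact ⟨p, hp⟩
      have f1 : front (y :: d :: r) = y :: d :: p := by rw [front_cons, hzp]; simp; omega
      have f2 : front (c :: y :: d :: r) = [] := by rw [front_cons, f1]; simp; omega
      have f3 : front (x :: c :: y :: d :: r) = [x] := by rw [front_cons, f2]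
      refine invoSpec_of_knuth e' ?_ (Or.inr ⟨hfl, by simp [f3], ?_⟩) (by simp) (by simp)
      · rw [invo_of_not (by simp; omega), knuth, if_neg (by omega), if_pos (by omega)]
      · right
        have a1 : anti (y :: d :: r) = anti (d :: r) := by
          rw [anti_cons, hzp]; simp; omega
        have hyc : y < c := by omega
        rw [hal, anti_cons c (d :: r), hzp, anti_cons x, f2, anti_cons c (y :: _), f1, a1]
        simp only [h3, hyc, if_true]
        rw [countP_le_of_lt y hyc]
        simp
    · obtain ⟨r, rfl⟩ := front_eq_cons hvp
      have hyz : y ≤ z := hp z rfl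
      have hyz' : y ≠ z := by rintro rfl; simp at hl
      have hxz : x ≠ z := by rintro rfl; simp at hx
      obtain ⟨-, hr, hp'⟩ := front_cons_eq hvp
      rcases lt_or_gt_of_ne hxz with hxz | hxz
      · have e' : invo (x :: y :: z :: r) = x :: z :: y :: r := by
          rw [e, knuth, if_neg (by omega), if_pos (by omega)]
        have hpz := le_of_mem_front hvp
        have f1 : front (y :: r) = y :: p := by
          rw [front_cons, hr]; cases p with
          | nil => rfl
          | cons q p => simp at hpz ⊢; omega
        have a1 : anti (y :: r) = anti r := by
          rw [anti_cons, hr]; cases p with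
          | nil => rfl
          | cons q p => simp at hpz ⊢; omega
        have az : anti (z :: r) = anti r := by
          rw [anti_cons, hr]; cases p with
          | nil => rfl
          | cons q p => simp at hpz ⊢; omega
        have hyz'' : y < z := by omega
        have f2 : front (z :: y :: r) = [] := by rw [front_cons, f1]; simp; omega
        have f3 : front (x :: z :: y :: r) = [x] := by rw [front_cons, f2]
        refine invoSpec_of_knuth e' ?_ (Or.inr ⟨hfl, by simp [f3], ?_⟩) (by simp) (by simp)
        · rw [invo_of_not (by simp; omega), knuth, if_neg (by omega), if_pos (by omega)]
        · right
          rw [hal, az, anti_cons x, f2, anti_cons z, f1, a1]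
          simp only [hyz'', if_true]
          rw [countP_le_of_lt y hyz'', countP_le_eq_length hpz, countP_le_eq_length (by grind)]
          simp; ring
      · have e' : invo (x :: y :: z :: r) = y :: x :: z :: r := by
          rw [e, knuth, if_pos (by omega)]
        have f1 : front (x :: z :: r) = [] := by rw [front_cons, hvp]; simp; omega
        have f2 : front (y :: x :: z :: r) = [y] := by rw [front_cons, f1]
        refine invoSpec_of_knuth e' ?_ (Or.inr ⟨hfl, by simp [f2], ?_⟩) ?_ ?_
        · rw [invo_of_not (by simp; omega), knuth, if_pos (by omega)]
        · left
          rw [hal, anti_cons y, f1, anti_cons x, hvp]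
          simp only [hxz, if_true]; ring
        · simp; omega
        · simp [hfl]

/-- Letter `3 * b`, `3 * b + 1`, `3 * b + 2` stands for a value in block `b` at an excedance of the
inverse, a fixed point, an anti-excedance of the inverse; `Allowed z y` says that `z` may occur
in the row of `y`. -/
def Allowed (z y : ℕ) : Prop :=
  (z % 3 = 0 ∧ y ≤ z ∧ y % 3 ≠ 1) ∨ (z % 3 = 2 ∧ z ≤ y ∧ y % 3 ≠ 1) ∨ (z % 3 = 1 ∧ z = y)

instance (z y : ℕ) : Decidable (Allowed z y) := by unfold Allowed; infer_instance

/-- The product of the factors `1 - X i` over `i < k` with `i % 3 ≠ 2`. -/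
def prodAC {A : Type*} [CommRing A] (X : ℕ → A) (k : ℕ) : A :=
  ∏ i ∈ (Finset.range k).filter (· % 3 ≠ 2), (1 - X i)

/-- The reciprocal of the generating series of rearrangements with allowed columns. -/
def recip {A : Type*} [CommRing A] (X : ℕ → A) : ℕ → A
  | 0 => 1
  | k + 1 => if k % 3 = 0 then recip X k - X k * prodAC X k else recip X k * (1 - X k)

theorem prodAC_succ {A : Type*} [CommRing A] (X : ℕ → A) (k : ℕ) :
    prodAC X (k + 1) = if k % 3 = 2 then prodAC X k else prodAC X k * (1 - X k) := by
  unfold prodAC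
  rw [Finset.range_add_one, Finset.filter_insert]
  by_cases h : k % 3 = 2
  · rw [if_pos h, if_neg (by simpa using h)]
  · rw [if_neg h, if_pos h, Finset.prod_insert (by simp), mul_comm]

theorem recip_step {A : Type*} [CommRing A] (X K : ℕ → A) (M : A) (r : ℕ)
    (hK : ∀ y < r, K y = X y * ∑ z ∈ (Finset.range (r + 1)).filter (Allowed · y), K z)
    (hr : K r = M + X r * ∑ z ∈ (Finset.range (r + 1)).filter (Allowed · r), K z)
    (hM : M * recip X r = 1) : K r * recip X (r + 1) = 1 := by
  set U : ℕ → A := fun y => ∑ z ∈ (Finset.range (r + 1)).filter (Allowed · y), K z with hU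
  set V : ℕ → A := fun k => ∑ z ∈ (Finset.range (r + 1)).filter
    (fun z => (z % 3 = 0 ∧ k ≤ z) ∨ (z % 3 = 2 ∧ z < k)), K z with hV
  set W : ℕ → A := fun k => ∑ z ∈ (Finset.range (r + 1)).filter
    (fun z => z % 3 = 0 ∧ k ≤ z), K z with hW
  have U0 : ∀ y ≤ r, y % 3 = 0 → U y = V y := by
    intro y hy h
    simp only [hU, hV]
    congr 1; ext z; simp only [Finset.mem_filter, Allowed]; grind
  have U1 : ∀ y ≤ r, y % 3 = 1 → U y = K y := by
    intro y hy h
    rw [← Finset.sum_singleton K y]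
    refine Finset.sum_congr ?_ fun _ _ => rfl
    ext z; simp only [Allowed, Finset.mem_singleton]; grind
  have U2 : ∀ y ≤ r, y % 3 = 2 → U y = V (y + 1) := by
    intro y hy h
    simp only [hU, hV]
    congr 1; ext z; simp only [Finset.mem_filter, Allowed]; grind
  have V0 : ∀ y ≤ r, y % 3 = 0 → V y = K y + V (y + 1) := by
    intro y hy h
    simp only [hV]
    rw [← Finset.sum_insert (a := y) (f := K) (by simp [h])]
    congr 1; ext z; simp only [Finset.mem_filter, Finset.mem_insert]; grind
  have V1 : ∀ y ≤ r, y % 3 = 1 → V (y + 1) = V y := by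
    intro y hy h
    simp only [hV]
    congr 1; ext z; simp only [Finset.mem_filter]; grind
  have V2 : ∀ y ≤ r, y % 3 = 2 → V (y + 1) = K y + V y := by
    intro y hy h
    simp only [hV]
    rw [← Finset.sum_insert (a := y) (f := K) (by simp [h])]
    congr 1; ext z; simp only [Finset.mem_filter, Finset.mem_insert]; grind
  have W0 : ∀ y ≤ r, y % 3 = 0 → W y = K y + W (y + 1) := by
    intro y hy h
    simp only [hW]
    rw [← Finset.sum_insert (a := y) (f := K) (by simp [h])]
    congr 1; ext z; simp only [Finset.mem_filter, Finset.mem_insert]; grind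
  have W1 : ∀ y ≤ r, y % 3 ≠ 0 → W (y + 1) = W y := by
    intro y hy h
    simp only [hW]
    congr 1; ext z; simp only [Finset.mem_filter]; grind
  have W3 : W (r + 1) = 0 := by
    simp only [hW]
    apply Finset.sum_eq_zero; intro z hz; simp at hz; omega
  have inv : ∀ k ≤ r, prodAC X k * W k = V k * recip X k := by
    intro k hk
    induction k with
    | zero => simp [prodAC, recip, hV, hW]
    | succ k ih =>
      have ih := ih (by omega)
      have hKk : K k = X k * U k := hK k (by omega)
      rw [prodAC_succ, recip]
      rcases (by omega : k % 3 = 0 ∨ k % 3 = 1 ∨ k % 3 = 2) with h | h | h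
      · rw [if_neg (by omega), if_pos h]
        rw [U0 k (by omega) h] at hKk
        have v := V0 k (by omega) h
        have w := W0 k (by omega) h
        linear_combination (1 - X k) * ih - (1 - X k) * prodAC X k * w
          + (recip X k - X k * prodAC X k) * v
          + (recip X k - X k * prodAC X k - (1 - X k) * prodAC X k) * hKk
      · rw [if_neg (by omega), if_neg (by omega), V1 k (by omega) h, W1 k (by omega) (by omega)]
        linear_combination (1 - X k) * ih
      · rw [if_pos h, if_neg (by omega), W1 k (by omega) (by omega)]
        rw [U2 k (by omega) h] at hKk
        have v := V2 k (by omega) h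
        linear_combination ih - recip X k * v - recip X k * hKk
  have invr := inv r le_rfl
  change K r = M + X r * U r at hr
  rw [recip]
  rcases (by omega : r % 3 = 0 ∨ r % 3 = 1 ∨ r % 3 = 2) with h | h | h
  · rw [if_pos h]
    rw [W0 r le_rfl h, W3] at invr
    rw [U0 r le_rfl h] at hr
    linear_combination hM - X r * invr + recip X r * hr
  · rw [if_neg (by omega)]
    rw [U1 r le_rfl h] at hr
    linear_combination hM + recip X r * hr
  · rw [if_neg (by omega)]
    rw [← W1 r le_rfl (by omega), W3] at invr
    have v : V r = 0 := by linear_combination -V r * hM - M * invr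
    rw [U2 r le_rfl h, V2 r le_rfl h, v] at hr
    linear_combination hM + recip X r * hr

open MvPowerSeries in
theorem coeff_X_mul_ite (m : ℕ →₀ ℕ) (s : ℕ) (φ : MvPowerSeries ℕ ℤ) :
    coeff m (X s * φ) = if m s = 0 then 0 else coeff (m - Finsupp.single s 1) φ := by
  rw [X, coeff_monomial_mul]
  simp only [Finsupp.single_le_iff, one_mul]
  split_ifs <;> first | rfl | omega

open MvPowerSeries in
theorem coeff_add_single_X_mul (m : ℕ →₀ ℕ) (s : ℕ) (φ : MvPowerSeries ℕ ℤ) :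
    coeff (m + Finsupp.single s 1) (X s * φ) = coeff m φ := by
  rw [coeff_X_mul_ite]; simp

section
open MvPowerSeries Finsupp
open scoped Classical

/-- The linear form of the letters below `N` allowed in row `y`. -/
noncomputable def rowForm (N y : ℕ) : MvPowerSeries ℕ ℤ :=
  ∑ z ∈ (Finset.range N).filter (Allowed · y), X z

/-- The product of the linear forms of all rows of a content. -/
noncomputable def rowProd (N : ℕ) (h : ℕ →₀ ℕ) : MvPowerSeries ℕ ℤ :=
  h.prod fun y k => rowForm N y ^ k

/-- The series counting rearrangements with allowed columns, for contents supported below `r`. -/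
noncomputable def part (N r : ℕ) : MvPowerSeries ℕ ℤ :=
  fun h => if ∀ i, r ≤ i → h i = 0 then coeff h (rowProd N h) else 0

/-- The variant of `part` counting incomplete rearrangements that start in row `y` and end
with the letter `r`. -/
noncomputable def walk (N r y : ℕ) : MvPowerSeries ℕ ℤ :=
  fun h => if ∀ i, r < i → h i = 0 then
    coeff (h + single r 1) (X y * rowProd N h) else 0

theorem rowProd_add_single (N y : ℕ) (h : ℕ →₀ ℕ) :
    rowProd N (h + single y 1) = rowForm N y * rowProd N h := by
  unfold rowProd
  rw [Finsupp.prod_add_index' (by simp) (by intros; rw [pow_add]),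
    Finsupp.prod_single_index (by simp), pow_one, mul_comm]

theorem coeff_walk (N r y : ℕ) (h : ℕ →₀ ℕ) : coeff h (walk N r y) =
    if ∀ i, r < i → h i = 0 then coeff (h + single r 1) (X y * rowProd N h) else 0 := rfl

theorem coeff_part (N r : ℕ) (h : ℕ →₀ ℕ) : coeff h (part N r) =
    if ∀ i, r ≤ i → h i = 0 then coeff h (rowProd N h) else 0 := rfl

theorem coeff_rowForm_mul {N r : ℕ} (hr : r < N) (y : ℕ) {h : ℕ →₀ ℕ}
    (hh : ∀ i, r < i → h i = 0) :
    coeff (h + single r 1) (rowForm N y * rowProd N h) =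
      coeff h (∑ z ∈ (Finset.range (r + 1)).filter (Allowed · y), walk N r z) := by
  rw [map_sum, rowForm, Finset.sum_mul, map_sum]
  symm
  apply Finset.sum_subset_zero_on_sdiff
  · intro z hz
    simp only [Finset.mem_filter, Finset.mem_range] at hz ⊢
    exact ⟨by omega, hz.2⟩
  · intro z hz
    simp only [Finset.mem_sdiff, Finset.mem_filter, Finset.mem_range, not_and] at hz
    have hz' : r < z := by
      by_contra hc
      exact hz.2 (by omega) hz.1.2
    rw [coeff_X_mul_ite, if_pos]
    simp [hh z hz', hz'.ne]
  · intro z hz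
    rw [coeff_walk, if_pos hh]

theorem exists_eq_add_single {h : ℕ →₀ ℕ} {y : ℕ} (hy : h y ≠ 0) :
    ∃ h', h = h' + single y 1 :=
  ⟨h - single y 1, by
    rw [tsub_add_cancel_of_le]; rw [single_le_iff]; omega⟩

theorem walk_eq {N r y : ℕ} (hr : r < N) (hy : y < r) :
    walk N r y = X y * ∑ z ∈ (Finset.range (r + 1)).filter (Allowed · y), walk N r z := by
  ext h
  by_cases h0 : h y = 0
  · rw [coeff_walk, coeff_X_mul_ite, coeff_X_mul_ite, if_pos h0]
    simp [h0, hy.ne']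
  · obtain ⟨h, rfl⟩ := exists_eq_add_single h0
    rw [coeff_add_single_X_mul, coeff_walk]
    have e : (∀ i, r < i → (h + single y 1 : ℕ →₀ ℕ) i = 0) ↔ ∀ i, r < i → h i = 0 := by
      refine forall₂_congr fun i hi => ?_
      simp [single_apply]; omega
    simp only [e]
    split_ifs with hh
    · rw [← coeff_rowForm_mul hr y hh, rowProd_add_single, add_right_comm,
        coeff_add_single_X_mul]
    · rw [map_sum]
      symm; apply Finset.sum_eq_zero
      intro z hz
      rw [coeff_walk, if_neg hh]

theorem walk_self (N r : ℕ) : walk N r r = part N (r + 1) := by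
  ext h
  rw [coeff_walk, coeff_part, coeff_add_single_X_mul]
  rfl

theorem walk_self_eq {N r : ℕ} (hr : r < N) :
    walk N r r = part N r +
      X r * ∑ z ∈ (Finset.range (r + 1)).filter (Allowed · r), walk N r z := by
  ext h
  rw [map_add, walk_self, coeff_part, coeff_part]
  by_cases h0 : h r = 0
  · rw [coeff_X_mul_ite, if_pos h0, add_zero]
    congr 1
    refine propext ⟨fun H i hi => ?_, fun H i hi => H i (by omega)⟩
    rcases hi.eq_or_lt with rfl | hi
    · exact h0
    · exact H i hi
  · rw [if_neg (c := ∀ i, r ≤ i → h i = 0) (fun H => h0 (H r le_rfl)), zero_add]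
    obtain ⟨h, rfl⟩ := exists_eq_add_single h0
    rw [coeff_add_single_X_mul]
    have e : (∀ i, r + 1 ≤ i → (h + single r 1 : ℕ →₀ ℕ) i = 0) ↔ ∀ i, r < i → h i = 0 := by
      refine forall₂_congr fun i hi => ?_
      simp [single_apply]; omega
    simp only [e]
    split_ifs with hh
    · rw [← coeff_rowForm_mul hr r hh, rowProd_add_single]
    · rw [map_sum]
      symm; apply Finset.sum_eq_zero
      intro z hz
      rw [coeff_walk, if_neg hh]

theorem part_zero (N : ℕ) : part N 0 = 1 := by
  ext h
  rw [coeff_part, coeff_one]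
  simp only [zero_le, true_imp_iff]
  by_cases e : h = 0
  · subst e; simp [rowProd]
  · rw [if_neg e, if_neg]; intro H; exact e (Finsupp.ext H)

theorem part_mul_recip (N k : ℕ) (hk : k ≤ N) : part N k * recip X k = 1 := by
  induction k with
  | zero => simp [part_zero, recip]
  | succ r ih =>
    rw [← walk_self]
    exact recip_step X (walk N r) (part N r) r (fun y hy => walk_eq hk hy) (walk_self_eq hk)
      (ih (by omega))

/-- The factor contributed by the row `y` taken `k` times, where for `y ∈ T` the last copy of
the row must not contain `y` itself. -/
noncomputable def strictPow (N : ℕ) (T : Finset ℕ) (y k : ℕ) : MvPowerSeries ℕ ℤ :=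
  if y ∈ T ∧ k ≠ 0 then rowForm N y ^ (k - 1) * (rowForm N y - X y) else rowForm N y ^ k

/-- The series counting rearrangements with allowed columns and the restriction of `strictPow`. -/
noncomputable def strictSeries (N : ℕ) (T : Finset ℕ) : MvPowerSeries ℕ ℤ :=
  fun h => if ∀ i, N ≤ i → h i = 0 then coeff h (h.prod (strictPow N T)) else 0

theorem coeff_strictSeries (N : ℕ) (T : Finset ℕ) (h : ℕ →₀ ℕ) : coeff h (strictSeries N T) =
    if ∀ i, N ≤ i → h i = 0 then coeff h (h.prod (strictPow N T)) else 0 := rfl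

theorem strictPow_zero (N : ℕ) (T : Finset ℕ) (y : ℕ) : strictPow N T y 0 = 1 := by
  simp [strictPow]

theorem prod_erase_strictPow (N : ℕ) {T : Finset ℕ} (h h' : ℕ →₀ ℕ) (y : ℕ)
    (hh : h.erase y = h'.erase y) :
    (h.erase y).prod (strictPow N (insert y T)) = (h'.erase y).prod (strictPow N T) := by
  rw [hh]
  refine Finset.prod_congr rfl fun i hi => ?_
  have : i ≠ y := by rintro rfl; simp at hi
  simp [strictPow, this]

theorem strictSeries_insert {N y : ℕ} (hy : y < N) {T : Finset ℕ} (hT : y ∉ T) :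
    strictSeries N (insert y T) = (1 - X y) * strictSeries N T := by
  ext h
  rw [sub_mul, one_mul, map_sub]
  by_cases h0 : h y = 0
  · rw [coeff_X_mul_ite, if_pos h0, sub_zero, coeff_strictSeries, coeff_strictSeries]
    congr 2
    rw [← Finsupp.mul_prod_erase' h y _ (fun i => strictPow_zero N _ i),
      ← Finsupp.mul_prod_erase' h y _ (fun i => strictPow_zero N _ i), h0, strictPow_zero,
      strictPow_zero, prod_erase_strictPow N h h y rfl]
  · obtain ⟨h, rfl⟩ := exists_eq_add_single h0
    rw [coeff_add_single_X_mul, coeff_strictSeries, coeff_strictSeries, coeff_strictSeries]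
    have e : (∀ i, N ≤ i → (h + single y 1 : ℕ →₀ ℕ) i = 0) ↔ ∀ i, N ≤ i → h i = 0 := by
      refine forall₂_congr fun i hi => ?_
      simp [single_apply]; omega
    simp only [e]
    split_ifs with hh
    · rw [← coeff_add_single_X_mul h y, ← map_sub]
      have e2 : (h + single y 1).erase y = h.erase y := by
        ext i; by_cases hi : i = y
        · subst hi; simp
        · simp [hi, Finsupp.erase_ne]
      rw [← Finsupp.mul_prod_erase' (h + single y 1) y _ (fun i => strictPow_zero N _ i),
        ← Finsupp.mul_prod_erase' (h + single y 1) y _ (fun i => strictPow_zero N _ i),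
        ← Finsupp.mul_prod_erase' h y _ (fun i => strictPow_zero N _ i),
        prod_erase_strictPow N (h + single y 1) h y e2, e2]
      congr 1
      simp [strictPow, hT]
      ring
    · simp

theorem strictSeries_empty (N : ℕ) : strictSeries N ∅ = part N N := by
  ext h
  have e : strictPow N ∅ = fun y k => rowForm N y ^ k := by
    funext y k
    simp [strictPow]
  rw [coeff_strictSeries, coeff_part, rowProd, e]

theorem strictSeries_eq {N : ℕ} {T : Finset ℕ} (hT : ∀ y ∈ T, y < N) :
    strictSeries N T = (∏ y ∈ T, (1 - X y)) * part N N := by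
  induction T using Finset.induction_on with
  | empty => simp [strictSeries_empty]
  | insert y T hy ih =>
    rw [strictSeries_insert (hT y (by simp)) hy, Finset.prod_insert hy,
      ih (fun z hz => hT z (by simp [hz])), mul_assoc]

theorem strictSeries_mul_recip {N : ℕ} {T : Finset ℕ} (hT : ∀ y ∈ T, y < N) :
    strictSeries N T * recip X N = ∏ y ∈ T, (1 - X y) := by
  rw [strictSeries_eq hT, mul_assoc, part_mul_recip N N le_rfl, mul_one]

end

section
open MvPowerSeries Finsupp
open scoped Classical

/-- The sum of `f` over all words of length `n` with letters below `R`. -/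
def wsum (R : ℕ) : ℕ → (List ℕ → ℤ) → ℤ
  | 0, f => f []
  | n + 1, f => ∑ a ∈ Finset.range R, wsum R n fun l => f (a :: l)

theorem wsum_congr {R : ℕ} : ∀ {n : ℕ} {f g : List ℕ → ℤ},
    (∀ l, (∀ x ∈ l, x < R) → l.length = n → f l = g l) → wsum R n f = wsum R n g
  | 0, _, _, h => h [] (by simp) rfl
  | n + 1, f, g, h => Finset.sum_congr rfl fun a ha => wsum_congr fun l hl hn =>
      h (a :: l) (by simp_all) (by simp [hn])

theorem wsum_add (R : ℕ) : ∀ (n : ℕ) (f g : List ℕ → ℤ),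
    wsum R n (fun l => f l + g l) = wsum R n f + wsum R n g
  | 0, _, _ => rfl
  | n + 1, f, g => by simp only [wsum, wsum_add R n, Finset.sum_add_distrib]

theorem wsum_zero (R : ℕ) : ∀ n : ℕ, wsum R n (fun _ => 0) = 0
  | 0 => rfl
  | n + 1 => by simp only [wsum, wsum_zero R n, Finset.sum_const_zero]

/-- The generating series of the words with property `P` by the content `c`. -/
noncomputable def wseries (R : ℕ) (P : List ℕ → Prop) (c : List ℕ → ℕ →₀ ℕ) :
    MvPowerSeries ℕ ℤ :=
  fun h => wsum R h.degree fun l => if P l ∧ c l = h then 1 else 0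

theorem coeff_wseries (R : ℕ) (P : List ℕ → Prop) (c : List ℕ → ℕ →₀ ℕ) (h : ℕ →₀ ℕ) :
    coeff h (wseries R P c) = wsum R h.degree fun l => if P l ∧ c l = h then 1 else 0 := rfl

theorem wseries_congr {R : ℕ} {P Q : List ℕ → Prop} {c d : List ℕ → ℕ →₀ ℕ}
    (hPQ : ∀ l, (∀ x ∈ l, x < R) → (P l ↔ Q l))
    (hcd : ∀ l, (∀ x ∈ l, x < R) → P l → c l = d l) : wseries R P c = wseries R Q d := by
  ext h
  refine wsum_congr fun l hl _ => ?_
  rw [← hPQ l hl]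
  by_cases hP : P l
  · rw [hcd l hl hP]
  · simp [hP]

theorem wseries_eq_add (R : ℕ) (P Q : List ℕ → Prop) (c : List ℕ → ℕ →₀ ℕ) :
    wseries R P c = wseries R (fun l => P l ∧ Q l) c + wseries R (fun l => P l ∧ ¬ Q l) c := by
  ext h
  rw [map_add, coeff_wseries, coeff_wseries, coeff_wseries, ← wsum_add]
  refine wsum_congr fun l _ _ => ?_
  by_cases hQ : Q l <;> simp [hQ]

theorem wsum_shift (R s n : ℕ) (P : List ℕ → Prop) (c : List ℕ → ℕ →₀ ℕ) (h : ℕ →₀ ℕ)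
    (hn : h.degree = n + 1) :
    wsum R n (fun l => if P l ∧ c l + single s 1 = h then 1 else 0) =
      coeff h (X s * wseries R P c) := by
  rw [coeff_X_mul_ite]
  split_ifs with h0
  · refine (wsum_congr fun l _ _ => if_neg ?_).trans (wsum_zero R n)
    rintro ⟨-, rfl⟩
    simp at h0
  · obtain ⟨h, rfl⟩ := exists_eq_add_single h0
    rw [map_add, degree_single] at hn
    rw [add_tsub_cancel_right, coeff_wseries, show h.degree = n by omega]
    simp

theorem coeff_X_mul_of_degree_eq_zero (s : ℕ) (φ : MvPowerSeries ℕ ℤ) (h : ℕ →₀ ℕ)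
    (hn : h.degree = 0) : coeff h (X s * φ) = 0 := by
  rw [degree_eq_zero_iff] at hn
  subst hn
  simp [coeff_X_mul_ite]

/-- The content of a hook with first letter `a` and remaining letters `p`. -/
noncomputable def hookContent (col : ℕ → ℕ) (p : List ℕ) : ℕ →₀ ℕ :=
  (p.map fun z => single (col z) 1).sum

/-- The content of all hooks of a word. -/
noncomputable def body : List ℕ → ℕ →₀ ℕ
  | [] => 0
  | a :: l => body l + match front l with
    | [] => 0
    | x :: p => if x < a then
        hookContent (fun z => if z < a then 3 * z + 2 else 3 * z) (x :: p) + single (3 * a) 1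
      else 0

theorem body_cons (a : ℕ) (l : List ℕ) : body (a :: l) = body l + match front l with
    | [] => 0
    | x :: p => if x < a then
        hookContent (fun z => if z < a then 3 * z + 2 else 3 * z) (x :: p) + single (3 * a) 1
      else 0 := rfl

/-- The content of a word whose front letters are colored by `col`. -/
noncomputable def content (col : ℕ → ℕ) (l : List ℕ) : ℕ →₀ ℕ :=
  body l + hookContent col (front l)

/-- The series of the words with front letters at least `j`. -/
noncomputable def frontSeries (R : ℕ) (col : ℕ → ℕ) (j : ℕ) : MvPowerSeries ℕ ℤ :=
  wseries R (fun l => ∀ x ∈ front l, j ≤ x) (content col)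

/-- The series of the words with empty front. -/
noncomputable def hookSeries (R : ℕ) : MvPowerSeries ℕ ℤ :=
  wseries R (fun l => front l = []) body

theorem mem_of_mem_front {l : List ℕ} {x : ℕ} (h : x ∈ front l) : x ∈ l := by
  induction l with
  | nil => exact h
  | cons a l ih =>
    rw [front_cons] at h
    split at h <;> grind

theorem frontSeries_step {R j : ℕ} (hj : j < R) (col : ℕ → ℕ) :
    frontSeries R col j = frontSeries R col (j + 1) + X (col j) * frontSeries R col j := by
  conv_lhs => rw [frontSeries, wseries_eq_add R _ (fun l => ∀ x ∈ front l, j + 1 ≤ x)]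
  congr 1
  · refine wseries_congr (fun l _ => ?_) (fun _ _ _ => rfl)
    exact ⟨fun h => h.2, fun h => ⟨fun x hx => by have := h x hx; omega, h⟩⟩
  · ext h
    rw [coeff_wseries]
    rcases hn : h.degree with _ | n
    · rw [coeff_X_mul_of_degree_eq_zero _ _ _ hn]
      simp [wsum, front]
    · rw [frontSeries, ← wsum_shift R (col j) n _ _ h hn, wsum,
        Finset.sum_eq_single_of_mem j (by simpa using hj)]
      · refine wsum_congr fun l _ _ => ?_
        rcases hl : front l with _ | ⟨x, p⟩
        · have e : front (j :: l) = [j] := by rw [front_cons, hl]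
          simp [content, e, hl, body_cons, hookContent]
        · by_cases hx : x < j
          · have e : front (j :: l) = [] := by rw [front_cons, hl]; simp [hx]
            rw [if_neg (by simp [e]), if_neg (by simp; omega)]
          · have e : front (j :: l) = j :: x :: p := by rw [front_cons, hl]; simp [hx]
            have e2 : content col (j :: l) = content col l + single (col j) 1 := by
              simp [content, e, hl, body_cons, hookContent, hx]
              abel
            rw [e, e2]
            simp
      · intro a _ ha
        refine (wsum_congr fun l _ _ => if_neg ?_).trans (wsum_zero R n)
        rintro ⟨⟨h1, h2⟩, -⟩
        rcases e : front (a :: l) with _ | ⟨x, p⟩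
        · simp [e] at h2
        · obtain ⟨rfl, -⟩ := front_cons_eq e
          have := le_of_mem_front e
          apply h2
          rw [e] at h1 ⊢
          intro y hy
          have h3 := h1 a (by simp)
          rcases List.mem_cons.1 hy with rfl | hy
          · omega
          · have := this y hy
            omega

theorem frontSeries_top (R : ℕ) (col : ℕ → ℕ) : frontSeries R col R = hookSeries R := by
  have key : ∀ l : List ℕ, (∀ x ∈ l, x < R) → (∀ x ∈ front l, R ≤ x) → front l = [] := by
    intro l hl h
    rw [List.eq_nil_iff_forall_not_mem]
    intro x hx
    exact absurd (hl x (mem_of_mem_front hx)) (h x hx).not_gt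
  refine wseries_congr (fun l hl => ⟨key l hl, ?_⟩) (fun l hl h => ?_)
  · intro h; simp [h]
  · simp [content, key l hl h, hookContent]

theorem frontSeries_congr (R j : ℕ) {col col' : ℕ → ℕ} (h : ∀ z, j ≤ z → col z = col' z) :
    frontSeries R col j = frontSeries R col' j := by
  refine wseries_congr (fun l _ => Iff.rfl) (fun l _ hl => ?_)
  rw [content, content, hookContent, hookContent]
  congr 2
  refine List.map_congr_left fun z hz => ?_
  rw [h z (hl z hz)]

theorem hookSeries_eq (R : ℕ) : hookSeries R = 1 + ∑ y ∈ Finset.range R, X (3 * y) *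
    (frontSeries R (fun z => if z < y then 3 * z + 2 else 3 * z) 0 -
      frontSeries R (fun z => if z < y then 3 * z + 2 else 3 * z) y) := by
  have hsub : ∀ y, (frontSeries R (fun z => if z < y then 3 * z + 2 else 3 * z) 0 -
      frontSeries R (fun z => if z < y then 3 * z + 2 else 3 * z) y) =
      wseries R (fun l => ¬ ∀ x ∈ front l, y ≤ x)
        (content (fun z => if z < y then 3 * z + 2 else 3 * z)) := by
    intro y
    rw [frontSeries, wseries_eq_add R _ (fun l => ∀ x ∈ front l, y ≤ x), frontSeries]
    simp
  simp only [hsub]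
  ext h
  rw [hookSeries, coeff_wseries, map_add, map_sum, coeff_one]
  rcases hn : h.degree with _ | n
  · rw [Finset.sum_eq_zero (fun y _ => coeff_X_mul_of_degree_eq_zero _ _ _ hn)]
    simp [wsum, front, body, eq_comm]
  · rw [if_neg (by rintro rfl; simp at hn), zero_add, wsum]
    refine Finset.sum_congr rfl fun y _ => ?_
    rw [← wsum_shift _ _ n _ _ h hn]
    refine wsum_congr fun l _ _ => ?_
    rcases hl : front l with _ | ⟨x, p⟩
    · rw [if_neg (by simp [front_cons, hl]), if_neg (by simp)]
    · by_cases hx : x < y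
      · have e2 : body (y :: l) =
            content (fun z => if z < y then 3 * z + 2 else 3 * z) l + single (3 * y) 1 := by
          rw [body_cons, content, hl]
          simp [hx, add_assoc]
        rw [e2, front_cons, hl]
        have : ¬ ∀ z ∈ x :: p, y ≤ z := fun H => absurd (H x (by simp)) (by omega)
        simp only [hx, if_true, this, not_false_eq_true, true_and]
      · rw [if_neg (by simp [front_cons, hl, hx]), if_neg]
        have := le_of_mem_front hl
        rintro ⟨H, -⟩
        apply H
        intro z hz
        rcases List.mem_cons.1 hz with rfl | hz
        · omega
        · have := this z hz; omega

theorem prod_mul_eq {A : Type*} [CommRing A] (x T : ℕ → A) (R : ℕ)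
    (h : ∀ j < R, T j = T (j + 1) + x j * T j) {b : ℕ} (hb : b ≤ R) :
    (∏ j ∈ Finset.range b, (1 - x j)) * T 0 = T b := by
  induction b with
  | zero => simp
  | succ b ih =>
    rw [Finset.prod_range_succ]
    linear_combination (1 - x b) * ih (by omega) + h b (by omega)

theorem prodAC_three_mul {A : Type*} [CommRing A] (x : ℕ → A) (b : ℕ) :
    prodAC x (3 * b) = (∏ j ∈ Finset.range b, (1 - x (3 * j))) *
      ∏ j ∈ Finset.range b, (1 - x (3 * j + 1)) := by
  induction b with
  | zero => simp [prodAC]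
  | succ b ih =>
    rw [show 3 * (b + 1) = 3 * b + 1 + 1 + 1 by ring, prodAC_succ, prodAC_succ, prodAC_succ,
      if_pos (by omega), if_neg (by omega), if_neg (by omega), ih, Finset.prod_range_succ,
      Finset.prod_range_succ]
    ring

theorem recip_three_mul {A : Type*} [CommRing A] (x : ℕ → A) (b : ℕ) :
    recip x (3 * (b + 1)) = (recip x (3 * b) - x (3 * b) * prodAC x (3 * b)) *
      (1 - x (3 * b + 1)) * (1 - x (3 * b + 2)) := by
  rw [show 3 * (b + 1) = 3 * b + 1 + 1 + 1 by ring, recip, recip, recip,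
    if_neg (by omega), if_neg (by omega), if_pos (by omega)]

theorem frontSeries_mul_recip_A (R : ℕ) :
    frontSeries R (3 * ·) 0 * recip X (3 * R) =
      (∏ j ∈ Finset.range R, (1 - X (3 * j + 2))) *
        ∏ j ∈ Finset.range R, (1 - X (3 * j + 1)) := by
  set T : ℕ → MvPowerSeries ℕ ℤ := frontSeries R (3 * ·) with hT
  set Y : ℕ → MvPowerSeries ℕ ℤ := fun y =>
    frontSeries R (fun z => if z < y then 3 * z + 2 else 3 * z) 0 with hY
  have hTstep : ∀ j < R, T j = T (j + 1) + X (3 * j) * T j := fun j hj => frontSeries_step hj _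
  have hTY : ∀ y < R, (∏ j ∈ Finset.range y, (1 - X (3 * j + 2))) * Y y = T y := by
    intro y hy
    have := prod_mul_eq (fun j => X (if j < y then 3 * j + 2 else 3 * j))
      (frontSeries R (fun z => if z < y then 3 * z + 2 else 3 * z)) R
      (fun j hj => frontSeries_step hj _) hy.le
    rw [hT, ← frontSeries_congr R y (col := fun z => if z < y then 3 * z + 2 else 3 * z)
      (fun z hz => by simp [hz.not_gt]), ← this]
    congr 1
    refine Finset.prod_congr rfl fun j hj => ?_
    rw [if_pos (by simpa using hj)]
  have hY0 : T 0 = 1 + ∑ y ∈ Finset.range R, X (3 * y) * Y y := by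
    have h1 := hookSeries_eq R
    rw [← frontSeries_top R (3 * ·)] at h1
    have h2 : ∑ y ∈ Finset.range R, (T y - T (y + 1)) = T 0 - T R := Finset.sum_range_sub' T R
    have h3 : ∑ y ∈ Finset.range R, (T y - T (y + 1)) =
        ∑ y ∈ Finset.range R, X (3 * y) * T y :=
      Finset.sum_congr rfl fun y hy => by
        have := hTstep y (by simpa using hy)
        linear_combination this
    have h4 : ∀ y, frontSeries R (fun z => if z < y then 3 * z + 2 else 3 * z) y = T y :=
      fun y => frontSeries_congr R y fun z hz => by simp [hz.not_gt]
    simp only [h4, mul_sub, Finset.sum_sub_distrib] at h1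
    linear_combination h1 - h2 + h3
  have key : ∀ b ≤ R, T 0 * recip X (3 * b) =
      (∏ j ∈ Finset.range b, (1 - X (3 * j + 2))) * (∏ j ∈ Finset.range b, (1 - X (3 * j + 1)))
        * (T 0 - ∑ y ∈ Finset.range b, X (3 * y) * Y y) := by
    intro b hb
    induction b with
    | zero => simp [recip]
    | succ b ih =>
      have ih := ih (by omega)
      have h1 := prod_mul_eq (fun j => X (3 * j)) T R hTstep (b := b) (by omega)
      rw [← hTY b (by omega)] at h1
      rw [recip_three_mul, prodAC_three_mul, Finset.prod_range_succ, Finset.prod_range_succ,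
        Finset.sum_range_succ]
      linear_combination (1 - X (3 * b + 1)) * (1 - X (3 * b + 2)) * ih -
        (1 - X (3 * b + 1)) * (1 - X (3 * b + 2)) * X (3 * b) *
        (∏ j ∈ Finset.range b, (1 - X (3 * j + 1))) * h1
  rw [key R le_rfl, hY0]
  ring

theorem prod_filter_three_mul {A : Type*} [CommRing A] (x : ℕ → A) (R : ℕ) :
    ∏ y ∈ (Finset.range (3 * R)).filter (· % 3 ≠ 1), (1 - x y) =
      (∏ j ∈ Finset.range R, (1 - x (3 * j))) * ∏ j ∈ Finset.range R, (1 - x (3 * j + 2)) := by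
  induction R with
  | zero => simp
  | succ R ih =>
    rw [Finset.prod_range_succ, Finset.prod_range_succ,
      show 3 * (R + 1) = 3 * R + 1 + 1 + 1 by ring, Finset.range_add_one, Finset.filter_insert,
      if_pos (by omega), Finset.prod_insert (by simp), Finset.range_add_one,
      Finset.filter_insert, if_neg (by omega), Finset.range_add_one, Finset.filter_insert,
      if_pos (by omega), Finset.prod_insert (by simp), ih]
    ring

theorem prod_one_sub_X_ne_zero (s : Finset ℕ) (f : ℕ → ℕ) :
    ∏ j ∈ s, (1 - X (f j) : MvPowerSeries ℕ ℤ) ≠ 0 := by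
  intro h
  have := congrArg constantCoeff h
  simp at this

theorem frontSeries_eq_strictSeries (R : ℕ) :
    frontSeries R (3 * · + 1) 0 =
      strictSeries (3 * R) ((Finset.range (3 * R)).filter (· % 3 ≠ 1)) := by
  have h1 := prod_mul_eq (fun j => X (3 * j + 1)) (frontSeries R (3 * · + 1)) R
    (fun j hj => frontSeries_step hj _) le_rfl
  have h2 := prod_mul_eq (fun j => X (3 * j)) (frontSeries R (3 * ·)) R
    (fun j hj => frontSeries_step hj _) le_rfl
  rw [frontSeries_top] at h1 h2
  have h3 := frontSeries_mul_recip_A R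
  have h4 := strictSeries_mul_recip (N := 3 * R)
    (T := (Finset.range (3 * R)).filter (· % 3 ≠ 1))
    (fun y hy => by simpa using (Finset.mem_filter.1 hy).1)
  rw [prod_filter_three_mul] at h4
  have h5 := part_mul_recip (3 * R) (3 * R) le_rfl
  have h6 : frontSeries R (3 * · + 1) 0 * recip X (3 * R) =
      (∏ j ∈ Finset.range R, (1 - X (3 * j))) * ∏ j ∈ Finset.range R, (1 - X (3 * j + 2)) := by
    apply mul_left_cancel₀ (prod_one_sub_X_ne_zero (Finset.range R) (3 * · + 1))
    linear_combination recip X (3 * R) * (h1 - h2) + (∏ j ∈ Finset.range R, (1 - X (3 * j))) * h3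
  linear_combination part (3 * R) (3 * R) * (h6 - h4) -
    (frontSeries R (3 * · + 1) 0 -
      strictSeries (3 * R) ((Finset.range (3 * R)).filter (· % 3 ≠ 1))) * h5

end

section
open MvPowerSeries Finsupp
open scoped Classical

/-- The content of a finite sequence. -/
noncomputable def cnt {n : ℕ} (u : Fin n → ℕ) : ℕ →₀ ℕ := ∑ j, single (u j) 1

theorem cnt_apply {n : ℕ} (u : Fin n → ℕ) (x : ℕ) :
    cnt u x = (Finset.univ.filter fun j => u j = x).card := by
  simp [cnt, Finsupp.finsetSum_apply, single_apply]

theorem cnt_comp_perm {n : ℕ} (u : Fin n → ℕ) (π : Equiv.Perm (Fin n)) :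
    cnt (u ∘ π) = cnt u :=
  Equiv.sum_comp π fun j => single (u j) 1

theorem exists_perm_of_cnt_eq {n : ℕ} {u c : Fin n → ℕ} (h : cnt u = cnt c) :
    ∃ π : Equiv.Perm (Fin n), u = c ∘ π := by
  have e : ∀ x, Nonempty ({j // u j = x} ≃ {j // c j = x}) := by
    intro x
    rw [← Fintype.card_eq, Fintype.card_subtype, Fintype.card_subtype, ← cnt_apply,
      ← cnt_apply, h]
  refine ⟨Equiv.ofFiberEquiv fun x => (e x).some, ?_⟩
  funext j
  exact (Equiv.ofFiberEquiv_map _ j).symm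

theorem eq_of_monotone_of_cnt_eq {n : ℕ} {u c : Fin n → ℕ} (hu : Monotone u) (hc : Monotone c)
    (h : cnt u = cnt c) : u = c := by
  obtain ⟨π, rfl⟩ := exists_perm_of_cnt_eq h
  exact Tuple.unique_monotone (f := c) (σ := π) (τ := 1) hu hc

theorem exists_cnt_eq (n : ℕ) (h : ℕ →₀ ℕ) (hn : h.degree = n) : ∃ c : Fin n → ℕ, cnt c = h := by
  induction n generalizing h with
  | zero =>
    rw [degree_eq_zero_iff] at hn
    exact ⟨fun _ => 0, by simp [cnt, hn]⟩
  | succ n ih =>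
    obtain ⟨y, hy⟩ : ∃ y, h y ≠ 0 := by
      by_contra! hc
      have : h = 0 := Finsupp.ext hc
      simp [this] at hn
    obtain ⟨h, rfl⟩ := exists_eq_add_single hy
    obtain ⟨c, rfl⟩ := ih h (by simpa using hn)
    refine ⟨Fin.cons y c, ?_⟩
    simp [cnt, Fin.sum_univ_succ, add_comm]

/-- The permutation `σ` is increasing on the fibers of `c`. -/
def IncOn {n : ℕ} (c : Fin n → ℕ) (σ : Equiv.Perm (Fin n)) : Prop :=
  ∀ i j, i < j → c i = c j → σ i < σ j

theorem incOn_iff {n : ℕ} {c : Fin n → ℕ} (hc : Monotone c) (σ : Equiv.Perm (Fin n)) :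
    IncOn c σ ↔ σ = Tuple.sort (c ∘ ⇑σ⁻¹) := by
  rw [Tuple.eq_sort_iff]
  have e : (c ∘ ⇑σ⁻¹) ∘ ⇑σ = c := by funext j; simp
  rw [e]
  simp [hc, IncOn]

theorem card_incOn {n N : ℕ} {c : Fin n → ℕ} (hc : Monotone c) (hN : ∀ j, c j < N)
    (P : (Fin n → ℕ) → Prop) :
    (Finset.univ.filter fun σ : Equiv.Perm (Fin n) => IncOn c σ ∧ P (c ∘ ⇑σ⁻¹)).card =
      ((Fintype.piFinset fun _ : Fin n => Finset.range N).filter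
        fun u => P u ∧ cnt u = cnt c).card := by
  refine Finset.card_nbij' (fun σ => c ∘ ⇑σ⁻¹) Tuple.sort ?_ ?_ ?_ ?_
  · intro σ hσ
    simp only [Finset.coe_filter, Finset.mem_univ, true_and, Set.mem_ofPred_eq,
      Fintype.mem_piFinset, Finset.mem_range] at hσ ⊢
    exact ⟨fun j => hN _, hσ.2, cnt_comp_perm c σ⁻¹⟩
  · intro u hu
    simp only [Finset.coe_filter, Finset.mem_univ, true_and, Set.mem_ofPred_eq,
      Fintype.mem_piFinset, Finset.mem_range] at hu ⊢
    have e : u ∘ Tuple.sort u = c := by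
      refine eq_of_monotone_of_cnt_eq (Tuple.monotone_sort u) hc ?_
      rw [cnt_comp_perm, hu.2.2]
    have e2 : c ∘ ⇑(Tuple.sort u)⁻¹ = u := by
      rw [← e]; funext j; simp
    rw [incOn_iff hc, e2]
    exact ⟨rfl, hu.2.1⟩
  · intro σ hσ
    simp only [Finset.coe_filter, Finset.mem_univ, true_and, Set.mem_ofPred_eq] at hσ
    exact ((incOn_iff hc σ).1 hσ.1).symm
  · intro u hu
    simp only [Finset.coe_filter, Fintype.mem_piFinset, Finset.mem_range,
      Set.mem_ofPred_eq] at hu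
    have e : u ∘ Tuple.sort u = c := by
      refine eq_of_monotone_of_cnt_eq (Tuple.monotone_sort u) hc ?_
      rw [cnt_comp_perm, hu.2.2]
    change c ∘ ⇑(Tuple.sort u)⁻¹ = u
    rw [← e]; funext j; simp

/-- The type of a position: `0` if the value is smaller, `1` if it is fixed, `2` if it is
larger. -/
def typ {n : ℕ} (σ : Equiv.Perm (Fin n)) (j : Fin n) : ℕ :=
  if σ j < j then 0 else if σ j = j then 1 else 2

/-- The letter `z` may stand in position `v` of the word of a permutation with types given
by `c`. -/
def Fits {n : ℕ} (c : Fin n → ℕ) (z : ℕ) (v : Fin n) : Prop :=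
  (z % 3 = 0 ∧ c v % 3 ≠ 1 ∧ (c v < z ∨ (c v = z ∧ ∃ e, v < e ∧ c e = c v))) ∨
  (z % 3 = 1 ∧ c v = z) ∨
  (z % 3 = 2 ∧ c v % 3 ≠ 1 ∧ (z < c v ∨ (c v = z ∧ ∃ e, e < v ∧ c e = c v)))

theorem IncOn.add_sub_le {n : ℕ} {c : Fin n → ℕ} (hc : Monotone c) {σ : Equiv.Perm (Fin n)}
    (hσ : IncOn c σ) {i j : Fin n} (hij : i ≤ j) (h : c i = c j) :
    (σ i : ℕ) + (j - i : ℕ) ≤ σ j := by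
  obtain ⟨d, hd⟩ : ∃ d : ℕ, (j : ℕ) = i + d := ⟨j - i, by have : (i : ℕ) ≤ j := hij; omega⟩
  induction d generalizing j with
  | zero =>
    have : i = j := Fin.ext (by omega)
    subst this; simp
  | succ d ih =>
    set k : Fin n := ⟨i + d, by omega⟩ with hk
    have hik : i ≤ k := by rw [Fin.le_def]; simp [hk]
    have hkj : k < j := by rw [Fin.lt_def]; simp [hk]; omega
    have hck : c i = c k := le_antisymm (hc hik) (h ▸ hc hkj.le)
    have h1 := ih hik hck (by simp [hk])
    have h2 : (σ k : ℕ) < σ j := hσ k j hkj (by rw [← hck, h])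
    simp only [hk] at h1 h2
    omega

theorem exists_first {n : ℕ} (c : Fin n → ℕ) (j : Fin n) :
    ∃ e, c e = c j ∧ ∀ i, c i = c j → e ≤ i := by
  obtain ⟨e, he, h⟩ := Finset.exists_min_image (Finset.univ.filter fun i => c i = c j) id
    ⟨j, by simp⟩
  simp only [Finset.mem_filter, Finset.mem_univ, true_and, id] at he h
  exact ⟨e, he, h⟩

theorem exists_last {n : ℕ} (c : Fin n → ℕ) (j : Fin n) :
    ∃ e, c e = c j ∧ ∀ i, c i = c j → i ≤ e := by
  obtain ⟨e, he, h⟩ := Finset.exists_max_image (Finset.univ.filter fun i => c i = c j) id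
    ⟨j, by simp⟩
  simp only [Finset.mem_filter, Finset.mem_univ, true_and, id] at he h
  exact ⟨e, he, h⟩

theorem typ_eq_iff_fits {n : ℕ} {c : Fin n → ℕ} (hc : Monotone c) {σ : Equiv.Perm (Fin n)}
    (hσ : IncOn c σ) : (∀ j, typ σ j = c j % 3) ↔ ∀ v, Fits c ((c ∘ ⇑σ⁻¹) v) v := by
  have e : (∀ v, Fits c ((c ∘ ⇑σ⁻¹) v) v) ↔ ∀ j, Fits c (c j) (σ j) := by
    constructor
    · intro h j; simpa using h (σ j)
    · intro h v; simpa using h (σ⁻¹ v)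
  rw [e]
  constructor
  · intro h j
    have hfix : σ j ≠ j → c (σ j) % 3 ≠ 1 := by
      intro hne h1
      have h2 := h (σ j)
      rw [h1, typ] at h2
      split_ifs at h2 with h3 h4
      · exact hne (σ.injective h4)
      · omega
    have hj := h j
    unfold typ at hj
    split_ifs at hj with h1 h2
    · left
      refine ⟨hj.symm, hfix h1.ne, ?_⟩
      rcases (hc h1.le).lt_or_eq with h3 | h3
      · exact Or.inl h3
      · exact Or.inr ⟨h3, j, h1, h3.symm⟩
    · right; left
      exact ⟨hj.symm, by rw [h2]⟩
    · right; right
      have h3 : j < σ j := lt_of_le_of_ne (not_lt.1 h1) (Ne.symm h2)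
      refine ⟨hj.symm, hfix h2, ?_⟩
      rcases (hc h3.le).lt_or_eq with h4 | h4
      · exact Or.inl h4
      · exact Or.inr ⟨h4.symm, j, h3, h4⟩
  · intro h j
    have up : c j % 3 ≠ 2 → c j % 3 = 1 ∨ c j % 3 = 0 := by omega
    obtain ⟨a, ha, ha'⟩ := exists_first c j
    obtain ⟨b, hb, hb'⟩ := exists_last c j
    have hja := hσ.add_sub_le hc (ha' j rfl) ha
    have hjb := hσ.add_sub_le hc (hb' j rfl) hb.symm
    have haj : (a : ℕ) ≤ j := ha' j rfl
    have hbj : (j : ℕ) ≤ b := hb' j rfl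
    have hA := h a
    have hB := h b
    have ltc : ∀ {p q : Fin n}, c p < c q → p < q := fun {p q} hpq =>
      lt_of_not_ge fun hge => absurd (hc hge) hpq.not_ge
    rcases (by omega : c j % 3 = 0 ∨ c j % 3 = 1 ∨ c j % 3 = 2) with h0 | h0 | h0
    · have h1 : σ b < b := by
        rcases hB with ⟨-, -, h2⟩ | ⟨h2, -⟩ | ⟨h2, -⟩
        · rcases h2 with h2 | ⟨h2, e, h3, h4⟩
          · exact ltc h2
          · exact h3.trans_le (hb' e (by rw [h4, h2, hb]))
        · rw [hb] at h2; omega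
        · rw [hb] at h2; omega
      rw [h0, typ, if_pos]
      rw [Fin.lt_def] at h1 ⊢
      omega
    · have h1 : a ≤ σ a := by
        rcases hA with ⟨h2, -⟩ | ⟨-, h2⟩ | ⟨h2, -⟩
        · rw [ha] at h2; omega
        · exact ha' _ (by rw [h2, ha])
        · rw [ha] at h2; omega
      have h2 : σ b ≤ b := by
        rcases hB with ⟨h2, -⟩ | ⟨-, h2⟩ | ⟨h2, -⟩
        · rw [hb] at h2; omega
        · exact hb' _ (by rw [h2, hb])
        · rw [hb] at h2; omega
      rw [Fin.le_def] at h1 h2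
      have : σ j = j := Fin.ext (by omega)
      simp [typ, this, h0]
    · have h1 : a < σ a := by
        rcases hA with ⟨h2, -⟩ | ⟨h2, -⟩ | ⟨-, -, h2⟩
        · rw [ha] at h2; omega
        · rw [ha] at h2; omega
        · rcases h2 with h2 | ⟨h2, e, h3, h4⟩
          · exact ltc h2
          · exact (ha' e (by rw [h4, h2, ha])).trans_lt h3
      rw [Fin.lt_def] at h1
      rw [h0, typ, if_neg (by rw [Fin.lt_def]; omega), if_neg (by rw [Fin.ext_iff]; omega)]

theorem coeff_prod_sum_X {n : ℕ} (t : Fin n → Finset ℕ) (h : ℕ →₀ ℕ) :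
    coeff h (∏ v, ∑ z ∈ t v, (X z : MvPowerSeries ℕ ℤ)) =
      ((Fintype.piFinset t).filter fun u => cnt u = h).card := by
  have e : ∀ u : Fin n → ℕ, ∏ v, (X (u v) : MvPowerSeries ℕ ℤ) = monomial (cnt u) 1 := by
    intro u
    have : ∀ s : Finset (Fin n), ∏ v ∈ s, (X (u v) : MvPowerSeries ℕ ℤ) =
        monomial (∑ v ∈ s, single (u v) 1) 1 := by
      intro s
      induction s using Finset.induction_on with
      | empty => simp
      | insert a s ha ih =>
        rw [Finset.prod_insert ha, Finset.sum_insert ha, ih, X, monomial_mul_monomial, one_mul]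
    exact this _
  rw [Finset.prod_univ_sum, map_sum]
  simp only [e, coeff_monomial]
  rw [Finset.card_filter]
  push_cast
  exact Finset.sum_congr rfl fun u _ => if_congr eq_comm rfl rfl

theorem prod_fits_eq {n N : ℕ} {c : Fin n → ℕ} (hN : ∀ j, c j < N) :
    ∏ v, ∑ z ∈ (Finset.range N).filter (Fits c · v), (X z : MvPowerSeries ℕ ℤ) =
      (cnt c).prod (strictPow N ((Finset.range N).filter (· % 3 ≠ 1))) := by
  rw [← Finset.prod_fiberwise_of_maps_to (t := Finset.range N) (g := c) (by simpa using hN),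
    Finsupp.prod_of_support_subset (s := Finset.range N) _ _ _
      (fun i _ => strictPow_zero N _ i)]
  swap
  · intro x hx
    rw [Finsupp.mem_support_iff, cnt_apply, Finset.card_ne_zero] at hx
    obtain ⟨j, hj⟩ := hx
    rw [← (Finset.mem_filter.1 hj).2]
    simpa using hN j
  refine Finset.prod_congr rfl fun y hy => ?_
  have hyN : y < N := by simpa using hy
  rw [cnt_apply]
  by_cases h1 : y % 3 = 1
  · rw [strictPow, if_neg (by simp [h1]), Finset.prod_eq_pow_card]
    intro v hv
    have hv : c v = y := (Finset.mem_filter.1 hv).2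
    rw [rowForm]
    refine Finset.sum_congr (Finset.filter_congr fun z _ => ?_) fun _ _ => rfl
    simp only [Fits, Allowed, hv, h1]
    simp [eq_comm]
  · rcases Finset.eq_empty_or_nonempty (Finset.univ.filter fun j => c j = y) with h0 | ⟨j, hj⟩
    · simp [h0, strictPow_zero]
    have hj : c j = y := (Finset.mem_filter.1 hj).2
    have hcard : (Finset.univ.filter fun j => c j = y).card ≠ 0 :=
      Finset.card_ne_zero_of_mem (a := j) (by simp [hj])
    rw [strictPow, if_pos ⟨by simp [h1, hyN], hcard⟩]
    obtain ⟨e, he, hfit⟩ : ∃ e, c e = y ∧ ∀ v, c v = y → ∀ z,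
        (Fits c z v ↔ Allowed z y ∧ ¬ (z = y ∧ v = e)) := by
      rcases (by omega : y % 3 = 0 ∨ y % 3 = 2) with h | h
      · obtain ⟨b, hb, hb'⟩ := exists_last c j
        refine ⟨b, by rw [hb, hj], fun v hv z => ?_⟩
        have key : (∃ e, v < e ∧ c e = y) ↔ v ≠ b := by
          constructor
          · rintro ⟨e, h1, h2⟩ rfl
            exact (hb' e (by rw [h2, hj])).not_gt h1
          · intro hne
            exact ⟨b, lt_of_le_of_ne (hb' v (by rw [hv, hj])) hne, by rw [hb, hj]⟩
        simp only [Fits, Allowed, hv, key]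
        by_cases hzy : z = y
        · subst hzy; simp [h]
        · have : (z < y) ↔ z ≤ y := ⟨le_of_lt, fun H => lt_of_le_of_ne H hzy⟩
          simp [hzy, Ne.symm hzy, h, this, lt_iff_le_and_ne]
      · obtain ⟨a, ha, ha'⟩ := exists_first c j
        refine ⟨a, by rw [ha, hj], fun v hv z => ?_⟩
        have key : (∃ e, e < v ∧ c e = y) ↔ v ≠ a := by
          constructor
          · rintro ⟨e, h1, h2⟩ rfl
            exact (ha' e (by rw [h2, hj])).not_gt h1
          · intro hne
            exact ⟨a, lt_of_le_of_ne (ha' v (by rw [hv, hj])) hne.symm, by rw [ha, hj]⟩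
        simp only [Fits, Allowed, hv, key]
        by_cases hzy : z = y
        · subst hzy; simp [h]
        · have : (z < y) ↔ z ≤ y := ⟨le_of_lt, fun H => lt_of_le_of_ne H hzy⟩
          simp [hzy, Ne.symm hzy, h, this, lt_iff_le_and_ne]
    have hmem : e ∈ Finset.univ.filter fun j => c j = y := by simp [he]
    rw [← Finset.mul_prod_erase _ _ hmem, mul_comm]
    congr 1
    · rw [Finset.prod_eq_pow_card, Finset.card_erase_of_mem hmem]
      intro v hv
      simp only [Finset.mem_erase, Finset.mem_filter, Finset.mem_univ, true_and] at hv
      rw [rowForm]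
      refine Finset.sum_congr (Finset.filter_congr fun z _ => ?_) fun _ _ => rfl
      rw [hfit v hv.2]; simp [hv.1]
    · have hall : y ∈ (Finset.range N).filter (Allowed · y) := by
        refine Finset.mem_filter.2 ⟨hy, ?_⟩
        unfold Allowed
        omega
      rw [rowForm, ← Finset.add_sum_erase _ _ hall, add_sub_cancel_left]
      refine Finset.sum_congr ?_ fun _ _ => rfl
      ext z
      simp only [Finset.mem_filter, Finset.mem_erase, hfit e he]
      tauto

/-- The colored content of a permutation with block labels `b`. -/
noncomputable def permContent {n : ℕ} (b : Fin n → ℕ) (σ : Equiv.Perm (Fin n)) : ℕ →₀ ℕ :=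
  cnt fun j => 3 * b j + typ σ j

theorem typ_lt {n : ℕ} (σ : Equiv.Perm (Fin n)) (j : Fin n) : typ σ j < 3 := by
  unfold typ; split_ifs <;> omega

theorem typ_mono {n : ℕ} (σ : Equiv.Perm (Fin n)) {i j : Fin n} (hij : i < j) {b : Fin n → ℕ}
    (hb : Monotone b) (hσ : IncOn b σ) (h : b i = b j) : typ σ i ≤ typ σ j := by
  have := hσ.add_sub_le hb hij.le h
  unfold typ
  simp only [Fin.lt_def, Fin.ext_iff] at *
  split_ifs <;> omega

theorem incOn_and_permContent_iff {n : ℕ} {b c : Fin n → ℕ} (hb : Monotone b) (hc : Monotone c)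
    (hbc : ∀ j, c j / 3 = b j) (σ : Equiv.Perm (Fin n)) :
    (IncOn b σ ∧ permContent b σ = cnt c) ↔ IncOn c σ ∧ ∀ j, typ σ j = c j % 3 := by
  constructor
  · rintro ⟨h1, h2⟩
    have hm : Monotone fun j => 3 * b j + typ σ j := by
      intro i j hij
      rcases hij.eq_or_lt with rfl | hij
      · rfl
      · have h3 := hb hij.le
        have h4 := typ_lt σ i
        rcases h3.eq_or_lt with h3 | h3
        · have := typ_mono σ hij hb h1 h3
          simp only; omega
        · simp only; omega
    have h3 := eq_of_monotone_of_cnt_eq hm hc h2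
    refine ⟨fun i j hij h => h1 i j hij (by rw [← hbc, ← hbc, h]), fun j => ?_⟩
    have h4 : 3 * b j + typ σ j = c j := congrFun h3 j
    have := typ_lt σ j
    omega
  · rintro ⟨h1, h2⟩
    refine ⟨fun i j hij h => ?_, ?_⟩
    · have h3 := hc hij.le
      rcases h3.eq_or_lt with h3 | h3
      · exact h1 i j hij h3
      · have h4 := h2 i
        have h5 := h2 j
        have h6 : typ σ i < typ σ j := by
          have := hbc i
          have := hbc j
          omega
        unfold typ at h6
        simp only [Fin.lt_def, Fin.ext_iff] at *
        split_ifs at h6 <;> omega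
    · rw [permContent]
      congr 1
      funext j
      rw [h2, ← hbc]; omega

theorem card_permContent {n R : ℕ} {b c : Fin n → ℕ} (hb : Monotone b) (hc : Monotone c)
    (hbc : ∀ j, c j / 3 = b j) (hR : ∀ j, b j < R) :
    ((Finset.univ.filter fun σ : Equiv.Perm (Fin n) =>
      IncOn b σ ∧ permContent b σ = cnt c).card : ℤ) =
    coeff (cnt c) (strictSeries (3 * R) ((Finset.range (3 * R)).filter (· % 3 ≠ 1))) := by
  have hN : ∀ j, c j < 3 * R := by
    intro j
    have := hbc j
    have := hR j
    omega
  rw [coeff_strictSeries, if_pos, ← prod_fits_eq hN, coeff_prod_sum_X]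
  · have e : (Finset.univ.filter fun σ : Equiv.Perm (Fin n) =>
        IncOn b σ ∧ permContent b σ = cnt c) = Finset.univ.filter fun σ : Equiv.Perm (Fin n) =>
          IncOn c σ ∧ ∀ v, Fits c ((c ∘ ⇑σ⁻¹) v) v := by
      refine Finset.filter_congr fun σ _ => ?_
      rw [incOn_and_permContent_iff hb hc hbc]
      exact and_congr_right fun h => typ_eq_iff_fits hc h
    have e' := card_incOn hc hN fun u => ∀ v, Fits c (u v) v
    rw [e]
    norm_cast
    refine Eq.trans (by convert e') (congrArg Finset.card ?_)
    ext u
    simp only [Finset.mem_filter, Fintype.mem_piFinset, forall_and]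
    tauto
  · intro i hi
    rw [cnt_apply, Finset.card_eq_zero, Finset.filter_eq_empty_iff]
    intro j _ h
    have := hN j
    omega

theorem wsum_eq_sum (R : ℕ) : ∀ (n : ℕ) (f : List ℕ → ℤ), wsum R n f =
    ∑ u ∈ Fintype.piFinset fun _ : Fin n => Finset.range R, f (List.ofFn u)
  | 0, f => by simp [wsum]
  | n + 1, f => by
    simp only [wsum, wsum_eq_sum R n]
    rw [← Finset.sum_product']
    refine Finset.sum_nbij' (fun p => Fin.cons p.1 p.2) (fun u => (u 0, Fin.tail u))
      ?_ ?_ ?_ ?_ ?_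
    · rintro ⟨a, u⟩ h
      simp only [Finset.mem_product, Fintype.mem_piFinset] at h ⊢
      intro j
      refine Fin.cases ?_ ?_ j
      · simpa using h.1
      · intro j; simpa using h.2 j
    · intro u h
      simp only [Finset.mem_product, Fintype.mem_piFinset] at h ⊢
      exact ⟨h 0, fun j => h j.succ⟩
    · rintro ⟨a, u⟩ _; simp
    · intro u _; simp
    · rintro ⟨a, u⟩ _; simp [List.ofFn_succ]

theorem mapDomain_hookContent (g col : ℕ → ℕ) (p : List ℕ) :
    (hookContent col p).mapDomain g = hookContent (g ∘ col) p := by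
  induction p with
  | nil => simp [hookContent]
  | cons a p ih =>
    simp only [hookContent, List.map_cons, List.sum_cons, mapDomain_add, mapDomain_single] at ih ⊢
    rw [ih]; rfl

theorem mapDomain_div_content (l : List ℕ) :
    (content (3 * · + 1) l).mapDomain (· / 3) = hookContent id l := by
  have e : ∀ a p, hookContent ((· / 3) ∘ fun z => if z < a then 3 * z + 2 else 3 * z) p =
      hookContent id p := by
    intro a p
    unfold hookContent
    congr 2
    funext z
    simp only [Function.comp, id]
    congr 1
    split_ifs <;> omega
  have e' : ∀ p, hookContent ((· / 3) ∘ (3 * · + 1)) p = hookContent id p := by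
    intro p
    unfold hookContent
    congr 2
    funext z
    simp only [Function.comp, id]
    congr 1
    omega
  induction l with
  | nil => simp [content, body, front, hookContent]
  | cons a l ih =>
    rw [content, mapDomain_add, mapDomain_hookContent, e'] at ih ⊢
    rw [body_cons, front_cons]
    have hc : ∀ p, hookContent id (a :: p) = single a 1 + hookContent id p := fun p => rfl
    rcases hl : front l with _ | ⟨x, p⟩
    · rw [hl] at ih
      simp only [hc, ← ih, add_zero]
      abel
    · rw [hl] at ih
      rw [hc l, ← ih]
      by_cases hx : x < a
      · simp only [hx, if_true, mapDomain_add, mapDomain_hookContent, e, mapDomain_single]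
        simp [hookContent]
        abel
      · simp only [hx, if_false, add_zero, hc]
        abel

theorem hookContent_id_ofFn {n : ℕ} (u : Fin n → ℕ) : hookContent id (List.ofFn u) = cnt u := by
  rw [hookContent, cnt, List.map_ofFn, List.sum_ofFn]
  rfl

theorem card_wordContent {n R : ℕ} {b : Fin n → ℕ} (hb : Monotone b) (hR : ∀ j, b j < R)
    {h : ℕ →₀ ℕ} (hn : h.degree = n) (hh : h.mapDomain (· / 3) = cnt b) :
    ((Finset.univ.filter fun ρ : Equiv.Perm (Fin n) =>
      IncOn b ρ ∧ content (3 * · + 1) (List.ofFn (b ∘ ⇑ρ⁻¹)) = h).card : ℤ) =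
    coeff h (frontSeries R (3 * · + 1) 0) := by
  have e : (Finset.univ.filter fun ρ : Equiv.Perm (Fin n) =>
      IncOn b ρ ∧ content (3 * · + 1) (List.ofFn (b ∘ ⇑ρ⁻¹)) = h).card =
      ((Fintype.piFinset fun _ : Fin n => Finset.range R).filter fun u =>
        content (3 * · + 1) (List.ofFn u) = h ∧ cnt u = cnt b).card := by
    convert card_incOn hb hR fun u => content (3 * · + 1) (List.ofFn u) = h
  rw [e, frontSeries, coeff_wseries, hn, wsum_eq_sum, Finset.card_filter]
  push_cast
  refine Finset.sum_congr rfl fun u _ => ?_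
  have key : content (3 * · + 1) (List.ofFn u) = h → cnt u = cnt b := by
    rintro rfl
    rw [← hh, mapDomain_div_content, hookContent_id_ofFn]
  split_ifs <;> simp_all

theorem degree_cnt {n : ℕ} (u : Fin n → ℕ) : (cnt u).degree = n := by
  simp [cnt]

theorem mapDomain_cnt {n : ℕ} (g : ℕ → ℕ) (u : Fin n → ℕ) :
    (cnt u).mapDomain g = cnt (g ∘ u) := by
  rw [cnt, mapDomain_finsetSum]
  simp [cnt, mapDomain_single]

theorem degree_mapDomain_nat (g : ℕ → ℕ) (h : ℕ →₀ ℕ) : (h.mapDomain g).degree = h.degree := by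
  induction h using Finsupp.induction_linear with
  | zero => simp
  | add f g hf hg => simp [mapDomain_add, hf, hg]
  | single a k => simp [mapDomain_single]

/-- Colored contents of permutations and of words are equidistributed. -/
theorem card_permContent_eq_card_wordContent {n : ℕ} {b : Fin n → ℕ} (hb : Monotone b)
    (h : ℕ →₀ ℕ) :
    (Finset.univ.filter fun σ : Equiv.Perm (Fin n) => IncOn b σ ∧ permContent b σ = h).card =
    (Finset.univ.filter fun ρ : Equiv.Perm (Fin n) =>
      IncOn b ρ ∧ content (3 * · + 1) (List.ofFn (b ∘ ⇑ρ⁻¹)) = h).card := by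
  by_cases hh : h.mapDomain (· / 3) = cnt b
  · obtain ⟨R, hR⟩ : ∃ R, ∀ j, b j < R :=
      ⟨∑ j, b j + 1, fun j => Nat.lt_succ_of_le
        (Finset.single_le_sum (fun _ _ => Nat.zero_le _) (Finset.mem_univ j))⟩
    have hn : h.degree = n := by rw [← degree_mapDomain_nat (· / 3), hh, degree_cnt]
    obtain ⟨c, rfl⟩ := exists_cnt_eq n h hn
    rw [← cnt_comp_perm c (Tuple.sort c)] at hh hn ⊢
    set d := c ∘ Tuple.sort c with hd
    have hdm : Monotone d := Tuple.monotone_sort c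
    rw [mapDomain_cnt] at hh
    have hdb : ∀ j, d j / 3 = b j := congrFun
      (eq_of_monotone_of_cnt_eq (fun i j hij => Nat.div_le_div_right (hdm hij)) hb hh)
    zify
    rw [card_permContent hb hdm hdb hR, card_wordContent hb hR hn (by rw [mapDomain_cnt, hh]),
      frontSeries_eq_strictSeries]
  · rw [Finset.filter_false_of_mem, Finset.filter_false_of_mem]
    · rintro ρ - ⟨-, rfl⟩
      apply hh
      rw [mapDomain_div_content, hookContent_id_ofFn, cnt_comp_perm]
    · rintro σ - ⟨-, rfl⟩
      apply hh
      rw [permContent, mapDomain_cnt]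
      congr 1
      funext j
      have := typ_lt σ j
      simp only [Function.comp]
      omega

end

section
open Finsupp

theorem hookContent_apply (f : ℕ → ℕ) (p : List ℕ) (k : ℕ) :
    hookContent f p k = p.countP (f · = k) := by
  induction p with
  | nil => simp [hookContent]
  | cons a p ih =>
    have : hookContent f (a :: p) = single (f a) 1 + hookContent f p := rfl
    rw [this, Finsupp.add_apply, ih, List.countP_cons, single_apply, add_comm]
    simp

theorem mapDomain_mod_body (l : List ℕ) :
    ((body l).mapDomain (· % 3)) 1 = 0 ∧ ((body l).mapDomain (· % 3)) 0 = anti l := by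
  induction l with
  | nil => simp [body, anti]
  | cons a l ih =>
    rw [body_cons, anti_cons]
    rcases hl : front l with _ | ⟨x, p⟩
    · simpa using ih
    · by_cases hx : x < a
      · simp only [hx, if_true, mapDomain_add, mapDomain_hookContent, mapDomain_single,
          Finsupp.add_apply, ih, hookContent_apply, single_apply]
        have e1 : (x :: p).countP (fun z => decide
            (((· % 3) ∘ fun z => if z < a then 3 * z + 2 else 3 * z) z = 1)) = 0 := by
          rw [List.countP_eq_zero]
          intro z _
          simp only [Function.comp, decide_eq_true_eq]
          split_ifs <;> omega
        have e0 : (x :: p).countP (fun z => decide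
            (((· % 3) ∘ fun z => if z < a then 3 * z + 2 else 3 * z) z = 0)) =
            (x :: p).countP (a ≤ ·) := by
          refine List.countP_congr fun z _ => ?_
          simp only [Function.comp, decide_eq_true_eq]
          split_ifs <;> omega
        rw [e1, e0]
        constructor
        · rw [if_neg (by omega)]; rfl
        · rw [if_pos (by omega)]; ring
      · simpa [hx] using ih

theorem mapDomain_mod_content_one (l : List ℕ) :
    ((content (3 * · + 1) l).mapDomain (· % 3)) 1 = (front l).length := by
  rw [content, mapDomain_add, Finsupp.add_apply, (mapDomain_mod_body l).1, mapDomain_hookContent,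
    hookContent_apply, zero_add, List.countP_eq_length]
  intro z _
  simp only [Function.comp, decide_eq_true_eq]
  omega

theorem mapDomain_mod_content_zero (l : List ℕ) :
    ((content (3 * · + 1) l).mapDomain (· % 3)) 0 = anti l := by
  rw [content, mapDomain_add, Finsupp.add_apply, (mapDomain_mod_body l).2, mapDomain_hookContent,
    hookContent_apply, Nat.add_eq_left, List.countP_eq_zero]
  intro z _
  simp only [Function.comp, decide_eq_true_eq]
  omega

theorem mapDomain_mod_permContent {n : ℕ} (b : Fin n → ℕ) (σ : Equiv.Perm (Fin n)) (k : ℕ) :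
    ((permContent b σ).mapDomain (· % 3)) k = (Finset.univ.filter fun j => typ σ j = k).card := by
  rw [permContent, mapDomain_cnt, cnt_apply]
  congr 1
  ext j
  have := typ_lt σ j
  simp only [Finset.mem_filter, Function.comp]
  rw [show (3 * b j + typ σ j) % 3 = typ σ j by omega]

end

theorem front_map {f : ℕ → ℕ} {l : List ℕ} (h : l.Pairwise fun a c => f c < f a ↔ c < a) :
    front (l.map f) = (front l).map f := by
  induction l with
  | nil => simp [front]
  | cons a l ih =>
    rw [List.pairwise_cons] at h
    rw [List.map_cons, front_cons, front_cons, ih h.2]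
    rcases hl : front l with _ | ⟨x, p⟩
    · rfl
    · have hx : x ∈ l := mem_of_mem_front (by simp [hl])
      simp only [List.map_cons, h.1 x hx]
      split_ifs <;> rfl

theorem anti_map {f : ℕ → ℕ} {l : List ℕ} (h : l.Pairwise fun a c => f c < f a ↔ c < a) :
    anti (l.map f) = anti l := by
  induction l with
  | nil => rfl
  | cons a l ih =>
    rw [List.pairwise_cons] at h
    rw [List.map_cons, anti_cons, anti_cons, ih h.2, front_map h.2]
    rcases hl : front l with _ | ⟨x, p⟩
    · rfl
    · have hx : ∀ z ∈ x :: p, z ∈ l := fun z hz => mem_of_mem_front (by rwa [hl])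
      have e : ((x :: p).map f).countP (f a ≤ ·) = (x :: p).countP (a ≤ ·) := by
        rw [List.countP_map]
        refine List.countP_congr fun z hz => ?_
        have := h.1 z (hx z hz)
        simp only [Function.comp, decide_eq_true_eq, ← not_lt, this]
      rw [List.map_cons] at e
      simp only [List.map_cons, h.1 x (hx x (by simp)), e]

/-- The word of the inverse of a permutation. -/
def invWord {n : ℕ} (ρ : Equiv.Perm (Fin n)) : List ℕ := List.ofFn fun v => (ρ⁻¹ v : ℕ)

/-- The block of a position when the blocks start at the elements of `K`. -/
def block (K : Finset ℕ) (j : ℕ) : ℕ := (K.filter (· ≤ j)).card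

theorem block_mono (K : Finset ℕ) : Monotone (block K) := fun i j hij =>
  Finset.card_le_card fun x => by simp only [Finset.mem_filter]; exact fun h => ⟨h.1, h.2.trans hij⟩

theorem block_succ_eq_iff {K : Finset ℕ} {j : ℕ} : block K (j + 1) = block K j ↔ j + 1 ∉ K := by
  have hs : K.filter (· ≤ j) ⊆ K.filter (· ≤ j + 1) := fun x => by
    simp only [Finset.mem_filter]; exact fun h => ⟨h.1, by omega⟩
  constructor
  · intro h hj
    have := Finset.eq_of_subset_of_card_le hs h.le
    have h2 : j + 1 ∈ K.filter (· ≤ j + 1) := by simp [hj]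
    rw [← this] at h2
    simp at h2
  · intro hj
    unfold block
    congr 1
    ext x
    simp only [Finset.mem_filter, and_congr_right_iff]
    intro hx
    have : x ≠ j + 1 := by rintro rfl; exact hj hx
    omega

theorem permToFun_succ {n : ℕ} (σ : Equiv.Perm (Fin n)) (i : Fin n) :
    permToFun σ (i + 1) = σ i + 1 := by
  rw [permToFun, dif_pos ⟨by omega, by omega⟩]
  simp

theorem succ_mem_desSet {n : ℕ} {σ : Equiv.Perm (Fin n)} {i : ℕ} (h : i + 1 < n) :
    i + 1 ∈ desSet σ ↔ σ ⟨i + 1, h⟩ < σ ⟨i, by omega⟩ := by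
  have h1 := permToFun_succ σ ⟨i + 1, h⟩
  have h2 := permToFun_succ σ ⟨i, by omega⟩
  simp only at h1 h2
  rw [desSet, Finset.mem_filter, h1, h2, Finset.mem_Icc, Fin.lt_def]
  omega

theorem eq_succ_of_mem_desSet {n : ℕ} {σ : Equiv.Perm (Fin n)} {i : ℕ} (h : i ∈ desSet σ) :
    ∃ j, i = j + 1 ∧ j + 1 < n := by
  rw [desSet, Finset.mem_filter, Finset.mem_Icc] at h
  exact ⟨i - 1, by omega, by omega⟩

theorem desSet_subset_iff {n : ℕ} (K : Finset ℕ) (σ : Equiv.Perm (Fin n)) :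
    desSet σ ⊆ K ↔ IncOn (fun j : Fin n => block K j) σ := by
  constructor
  · intro h i j hij hb
    obtain ⟨i, hi⟩ := i
    obtain ⟨j, hj⟩ := j
    rw [Fin.mk_lt_mk] at hij
    simp only at hb
    induction j with
    | zero => omega
    | succ j ih =>
      have hle := block_mono K (Nat.lt_succ_iff.1 hij)
      have hle' := block_mono K (Nat.le_succ j)
      have hK : j + 1 ∉ desSet σ := fun hm =>
        block_succ_eq_iff.1 (le_antisymm (by omega) hle') (h hm)
      rw [succ_mem_desSet hj, not_lt] at hK
      have hK : σ ⟨j, by omega⟩ < σ ⟨j + 1, hj⟩ :=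
        lt_of_le_of_ne hK (by simp)
      rcases (Nat.lt_succ_iff.1 hij).eq_or_lt with rfl | hlt
      · exact hK
      · exact (ih (by omega) hlt (by simp only [Nat.succ_eq_add_one] at hle'; omega)).trans hK
  · intro h i hi
    obtain ⟨j, rfl, hj⟩ := eq_succ_of_mem_desSet hi
    by_contra hK
    rw [succ_mem_desSet hj] at hi
    refine (h ⟨j, by omega⟩ ⟨j + 1, hj⟩ ?_ ?_).not_gt hi
    · simp
    · exact (block_succ_eq_iff.2 hK).symm

theorem pairwise_invWord {n : ℕ} {b : ℕ → ℕ} (hb : Monotone b) {ρ : Equiv.Perm (Fin n)}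
    (h : IncOn (fun j : Fin n => b j) ρ) :
    (invWord ρ).Pairwise fun a c => b c < b a ↔ c < a := by
  rw [invWord, List.pairwise_ofFn]
  intro v v' hv
  constructor
  · intro hlt
    exact lt_of_not_ge fun hge => (hb hge).not_gt hlt
  · intro hlt
    refine lt_of_le_of_ne (hb hlt.le) fun he => ?_
    have := h (ρ⁻¹ v') (ρ⁻¹ v) hlt he
    rw [← Equiv.Perm.mul_apply, ← Equiv.Perm.mul_apply, mul_inv_cancel] at this
    exact this.not_gt hv

theorem map_invWord {n : ℕ} (b : ℕ → ℕ) (ρ : Equiv.Perm (Fin n)) :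
    (invWord ρ).map b = List.ofFn ((fun j : Fin n => b j) ∘ ⇑ρ⁻¹) := by
  rw [invWord, List.map_ofFn]
  rfl

theorem sum_comp_eq_of_card_fiber_eq {ι κ M : Type*} [DecidableEq κ] [AddCommMonoid M]
    {s : Finset ι} {F G : ι → κ}
    (h : ∀ k, (s.filter fun i => F i = k).card = (s.filter fun i => G i = k).card) (g : κ → M) :
    ∑ i ∈ s, g (F i) = ∑ i ∈ s, g (G i) := by
  have e : s.val.map F = s.val.map G := by
    ext k
    have := h k
    simp only [Finset.card_def, Finset.filter_val] at this
    simp only [Multiset.count_map, eq_comm (a := k), this]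
  have := congrArg (fun m => (m.map g).sum) e
  rw [Multiset.map_map, Multiset.map_map] at this
  exact this

theorem sum_filter_eq_of_sum_filter_subset {α M : Type*} [Fintype α] [AddCommGroup M]
    (D : α → Finset ℕ) {A B : α → M}
    (h : ∀ K, ∑ x with D x ⊆ K, A x = ∑ x with D x ⊆ K, B x) (J : Finset ℕ) :
    ∑ x with D x = J, A x = ∑ x with D x = J, B x := by
  induction J using Finset.strongInduction with
  | H J ih =>
    have key : ∀ f : α → M, ∑ x with D x ⊆ J, f x =
        ∑ x with D x = J, f x + ∑ L ∈ J.ssubsets, ∑ x with D x = L, f x := by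
      intro f
      rw [← Finset.sum_fiberwise_of_maps_to (t := J.powerset) (g := D) (by simp),
        ← Finset.insert_erase (Finset.mem_powerset_self J), Finset.sum_insert (by simp)]
      congr 1
      · rw [Finset.filter_filter]
        refine Finset.sum_congr (Finset.filter_congr fun x _ => ?_) fun _ _ => rfl
        exact ⟨fun h => h.2, fun h => ⟨h.subset, h⟩⟩
      · refine Finset.sum_congr rfl fun L hL => ?_
        rw [Finset.filter_filter]
        refine Finset.sum_congr (Finset.filter_congr fun x _ => ?_) fun _ _ => rfl
        have hL := (Finset.mem_ssubsets.1 hL).subset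
        exact ⟨fun h => h.2, fun h => ⟨h ▸ hL, h⟩⟩
    have hJ := h J
    rw [key, key, Finset.sum_congr rfl fun L hL => ih L (Finset.mem_ssubsets.1 hL)] at hJ
    exact add_right_cancel hJ

theorem typ_eq_one_iff {n : ℕ} {σ : Equiv.Perm (Fin n)} {j : Fin n} : typ σ j = 1 ↔ σ j = j := by
  unfold typ
  split_ifs with h1 h2 <;> simp_all [ne_of_lt]

theorem typ_eq_zero_iff {n : ℕ} {σ : Equiv.Perm (Fin n)} {j : Fin n} : typ σ j = 0 ↔ σ j < j := by
  unfold typ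
  split_ifs with h1 h2 <;> simp_all

theorem card_filter_Icc_eq {n : ℕ} (P : ℕ → Prop) [DecidablePred P] :
    ((Finset.Icc 1 n).filter P).card = (Finset.univ.filter fun j : Fin n => P (j + 1)).card := by
  symm
  refine Finset.card_bij (fun j _ => (j : ℕ) + 1) ?_ ?_ ?_
  · intro j hj
    simp only [Finset.mem_filter, Finset.mem_univ, true_and, Finset.mem_Icc] at hj ⊢
    exact ⟨by omega, hj⟩
  · intro i _ j _ h
    exact Fin.ext (by simpa using h)
  · intro i hi
    simp only [Finset.mem_filter, Finset.mem_Icc] at hi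
    obtain ⟨i, rfl⟩ : ∃ k, i = k + 1 := ⟨i - 1, by omega⟩
    exact ⟨⟨i, by omega⟩, by simpa using hi.2, rfl⟩

theorem fixCount_eq {n : ℕ} (σ : Equiv.Perm (Fin n)) :
    fixCount σ = (Finset.univ.filter fun j => typ σ j = 1).card := by
  rw [fixCount, card_filter_Icc_eq]
  congr 1
  ext j
  simp [permToFun_succ, typ_eq_one_iff, Fin.ext_iff]

theorem excCount_inv_eq {n : ℕ} (σ : Equiv.Perm (Fin n)) :
    excCount σ⁻¹ = (Finset.univ.filter fun j => typ σ j = 0).card := by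
  rw [excCount, card_filter_Icc_eq]
  refine Finset.card_equiv σ⁻¹ fun j => ?_
  simp [permToFun_succ, typ_eq_zero_iff]

/-- The pairs of statistics `(fix, iexc)` and (front length, number of negative letters) are
equidistributed on each descent class. -/
theorem sum_desSet_fixCount_eq {n : ℕ} (J : Finset ℕ) (f : ℕ) :
    ∑ σ : Equiv.Perm (Fin n) with desSet σ = J ∧ fixCount σ = f,
      (Polynomial.X : Polynomial ℤ) ^ excCount σ⁻¹ =
    ∑ ρ : Equiv.Perm (Fin n) with desSet ρ = J ∧ (front (invWord ρ)).length = f,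
      (Polynomial.X : Polynomial ℤ) ^ anti (invWord ρ) := by
  classical
  rw [← Finset.filter_filter, ← Finset.filter_filter, Finset.sum_filter fun σ => fixCount σ = f,
    Finset.sum_filter fun ρ => (front (invWord ρ)).length = f]
  refine sum_filter_eq_of_sum_filter_subset (M := Polynomial ℤ) desSet (fun K => ?_) J
  have hb : Monotone fun j : Fin n => block K j := fun i j hij => block_mono K hij
  have e := sum_comp_eq_of_card_fiber_eq
    (s := Finset.univ.filter fun σ : Equiv.Perm (Fin n) => desSet σ ⊆ K)
    (F := permContent fun j : Fin n => block K j)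
    (G := fun ρ => content (3 * · + 1) ((invWord ρ).map (block K)))
    (fun h => by
      have := card_permContent_eq_card_wordContent hb h
      simp only [Finset.filter_filter, desSet_subset_iff, map_invWord]
      convert this)
    (fun h => if (h.mapDomain (· % 3)) 1 = f then
      (Polynomial.X : Polynomial ℤ) ^ ((h.mapDomain (· % 3)) 0) else 0)
  simp only [mapDomain_mod_permContent, ← fixCount_eq, ← excCount_inv_eq,
    mapDomain_mod_content_one, mapDomain_mod_content_zero] at e
  rw [e]
  refine Finset.sum_congr rfl fun ρ hρ => ?_
  have hp := pairwise_invWord (block_mono K)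
    ((desSet_subset_iff K ρ).1 (Finset.mem_filter.1 hρ).2)
  rw [front_map hp, anti_map hp, List.length_map]

theorem exists_invWord_eq {n : ℕ} {ρ : Equiv.Perm (Fin n)} {l : List ℕ} (h : l.Perm (invWord ρ)) :
    ∃ ρ' : Equiv.Perm (Fin n), invWord ρ' = l := by
  have hlen : l.length = n := by rw [h.length_eq, invWord, List.length_ofFn]
  have hnd : l.Nodup := by
    rw [h.nodup_iff, invWord, List.nodup_ofFn]
    exact fun i j hij => ρ⁻¹.injective (Fin.ext hij)
  have hlt : ∀ i ∈ l, i < n := by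
    intro i hi
    rw [h.mem_iff, invWord, List.mem_ofFn] at hi
    obtain ⟨v, rfl⟩ := hi
    exact Fin.isLt _
  subst hlen
  let u : Fin l.length → Fin l.length := fun v => ⟨l.get v, hlt _ (l.get_mem v)⟩
  have hu : Function.Injective u := fun i j hij =>
    List.nodup_iff_injective_get.1 hnd (Fin.mk.inj_iff.1 hij)
  refine ⟨(Equiv.ofBijective u (Finite.injective_iff_bijective.1 hu))⁻¹, ?_⟩
  simp only [invWord, inv_inv, Equiv.ofBijective_apply, u]
  exact List.ofFn_get l

theorem invWord_injective {n : ℕ} : Function.Injective (invWord (n := n)) := by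
  intro ρ ρ' h
  have := List.ofFn_injective h
  exact inv_injective (Equiv.ext fun v => Fin.ext (congrFun this v))

theorem idxOf_invWord {n : ℕ} (ρ : Equiv.Perm (Fin n)) (i : Fin n) :
    (invWord ρ).idxOf (i : ℕ) = ρ i := by
  have hnd : (invWord ρ).Nodup := by
    rw [invWord, List.nodup_ofFn]
    exact fun i j hij => ρ⁻¹.injective (Fin.ext hij)
  have hlen : (ρ i : ℕ) < (invWord ρ).length := by simp [invWord]
  have := hnd.idxOf_getElem _ hlen
  simpa [invWord] using this

theorem desSet_eq_of_invo {n : ℕ} {ρ ρ' : Equiv.Perm (Fin n)}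
    (h : invWord ρ' = invo (invWord ρ)) : desSet ρ' = desSet ρ := by
  have key : ∀ i (hi : i + 1 < n), (i + 1 ∈ desSet ρ' ↔ i + 1 ∈ desSet ρ) := by
    intro i hi
    have := idxOf_invo_lt (invWord ρ) i
    rw [← h] at this
    have h1 := idxOf_invWord ρ ⟨i, by omega⟩
    have h2 := idxOf_invWord ρ ⟨i + 1, hi⟩
    have h3 := idxOf_invWord ρ' ⟨i, by omega⟩
    have h4 := idxOf_invWord ρ' ⟨i + 1, hi⟩
    simp only at h1 h2 h3 h4
    rw [h1, h2, h3, h4, ← Fin.lt_def, ← Fin.lt_def] at this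
    have ne : ∀ τ : Equiv.Perm (Fin n), τ ⟨i, by omega⟩ ≠ τ ⟨i + 1, hi⟩ := fun τ => by simp
    refine (succ_mem_desSet hi).trans (Iff.trans (not_iff_not.1 ?_) (succ_mem_desSet hi).symm)
    simp only [not_lt]
    exact (ne ρ').le_iff_lt.trans (this.trans (ne ρ).le_iff_lt.symm)
  ext i
  constructor
  · intro hi
    obtain ⟨j, rfl, hj⟩ := eq_succ_of_mem_desSet hi
    exact (key j hj).1 hi
  · intro hi
    obtain ⟨j, rfl, hj⟩ := eq_succ_of_mem_desSet hi
    exact (key j hj).2 hi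

theorem desSet_eq_of_pairwise_gt {n : ℕ} {ρ : Equiv.Perm (Fin n)}
    (h : (invWord ρ).Pairwise (· > ·)) : desSet ρ = Finset.Icc 1 (n - 1) := by
  rw [invWord, List.pairwise_ofFn] at h
  refine Finset.Subset.antisymm (Finset.filter_subset _ _) fun i hi => ?_
  rw [Finset.mem_Icc] at hi
  obtain ⟨i, rfl⟩ : ∃ k, i = k + 1 := ⟨i - 1, by omega⟩
  have hi : i + 1 < n := by omega
  rw [succ_mem_desSet hi]
  by_contra hc
  have hlt : ρ ⟨i, by omega⟩ < ρ ⟨i + 1, hi⟩ := lt_of_le_of_ne (not_lt.1 hc) (by simp)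
  have := h hlt
  simp at this

/-- For a proper subset `J ⊂ [n-1]`, the difference of the
`iexc`-generating polynomials (`iexc σ = exc σ⁻¹`) of derangements with descent set
`J` and of permutations with exactly one fixed point and descent set `J` is
`(s-1)·Q(s)` for a polynomial `Q` with nonnegative integer coefficients. -/
theorem iexc_poly_derangement_sub_oneFix (n : ℕ) (hn : 0 < n) (J : Finset ℕ)
    (hJ : J ⊂ Finset.Icc 1 (n - 1)) :
    ∃ Q : Polynomial ℤ, (∀ i, 0 ≤ Q.coeff i) ∧
      (∑ σ ∈ Finset.univ.filter
          (fun σ : Equiv.Perm (Fin n) => desSet σ = J ∧ fixCount σ = 0),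
          (Polynomial.X : Polynomial ℤ) ^ excCount σ⁻¹)
        - (∑ σ ∈ Finset.univ.filter
            (fun σ : Equiv.Perm (Fin n) => desSet σ = J ∧ fixCount σ = 1),
            (Polynomial.X : Polynomial ℤ) ^ excCount σ⁻¹)
        = (Polynomial.X - 1) * Q := by
  rw [sum_desSet_fixCount_eq, sum_desSet_fixCount_eq]
  choose ι hι using fun ρ : Equiv.Perm (Fin n) => exists_invWord_eq (invo_perm (invWord ρ))
  have spec : ∀ ρ : Equiv.Perm (Fin n), (front (invWord ρ)).length ≤ 1 →
      InvoSpec (invWord ρ) := fun ρ h => invoSpec _ (by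
    rw [invWord, List.nodup_ofFn]
    exact fun i j hij => ρ⁻¹.injective (Fin.ext hij)) h
  have hdes : ∀ ρ, desSet (ι ρ) = desSet ρ := fun ρ => desSet_eq_of_invo (hι ρ)
  have hinv : ∀ ρ, (front (invWord ρ)).length ≤ 1 → ι (ι ρ) = ρ := fun ρ h =>
    invWord_injective (by rw [hι, hι, (spec ρ h).inv])
  have halt : ∀ ρ, desSet ρ = J → (front (invWord ρ)).length ≤ 1 →
      (front (invWord ρ)).length + (front (invWord (ι ρ))).length = 1 := by
    intro ρ hρ h
    rcases (spec ρ h).alt with ⟨h1, -⟩ | h1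
    · exact absurd (hρ.symm.trans (desSet_eq_of_pairwise_gt h1)) hJ.ne
    · rwa [hι]
  have e : ∑ ρ : Equiv.Perm (Fin n) with desSet ρ = J ∧ (front (invWord ρ)).length = 0,
      (Polynomial.X : Polynomial ℤ) ^ anti (invWord ρ) =
      ∑ ρ : Equiv.Perm (Fin n) with desSet ρ = J ∧ (front (invWord ρ)).length = 1,
      (Polynomial.X : Polynomial ℤ) ^ anti (invWord (ι ρ)) := by
    refine Finset.sum_nbij' ι ι ?_ ?_ ?_ ?_ ?_ <;> intro ρ hρ <;>
      obtain ⟨h1, h2⟩ := (Finset.mem_filter.1 hρ).2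
    · have := halt ρ h1 (by omega)
      exact Finset.mem_filter.2 ⟨Finset.mem_univ _, (hdes ρ).trans h1, by omega⟩
    · have := halt ρ h1 (by omega)
      exact Finset.mem_filter.2 ⟨Finset.mem_univ _, (hdes ρ).trans h1, by omega⟩
    · exact hinv ρ (by omega)
    · exact hinv ρ (by omega)
    · rw [hinv ρ (by omega)]
  refine ⟨∑ ρ : Equiv.Perm (Fin n) with desSet ρ = J ∧ (front (invWord ρ)).length = 1,
    if anti (invWord (ι ρ)) = anti (invWord ρ) + 1 then Polynomial.X ^ anti (invWord ρ) else 0,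
    fun i => ?_, ?_⟩
  · rw [Polynomial.finsetSum_coeff]
    refine Finset.sum_nonneg fun ρ _ => ?_
    split_ifs
    · rw [Polynomial.coeff_X_pow]; split_ifs <;> simp
    · simp
  · rw [e, ← Finset.sum_sub_distrib, Finset.mul_sum]
    refine Finset.sum_congr rfl fun ρ hρ => ?_
    obtain ⟨h1, h2⟩ := (Finset.mem_filter.1 hρ).2
    have h3 := halt ρ h1 h2.le
    have h4 := (spec ρ h2.le).up h2 (by rw [← hι]; omega)
    rw [← hι] at h4
    rcases h4 with h4 | h4
    · rw [h4, if_neg (by omega)]; ring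
    · rw [h4, if_pos rfl]; ring
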